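/- Let ⟨X,<⟩ be a countably infinite ultrahomogeneous strict partial order which is not an antichain (i.e., there exist x, y ∈ X with x < y). Then for every linear order L the following are equivalent: (a) L is order-isomorphic to a maximal chain in the poset ⟨P(X) ∪ {∅}, ⊆⟩; (c) L is order-isomorphic to ⟨K, ≤⟩ for some compact set K ⊆ ℝ whose minimum is an accumulation point of K. -/

import Mathlib

open Set

/-- `A ⊆ X` is a copy of `⟨X,r⟩`: the range of a self-embedding of the relation `r`,
i.e. `A` with the induced order is order-isomorphic to `⟨X,r⟩`. -/
def IsCopy {X : Type*} (r : X → X → Prop) (A : Set X) : Prop :=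
  ∃ f : X → X, Function.Injective f ∧ Set.range f = A ∧ ∀ x y, r x y ↔ r (f x) (f y)

/-- The family `P(X)` of copies of `⟨X,r⟩`. -/
def Copies {X : Type*} (r : X → X → Prop) : Set (Set X) :=
  {A | IsCopy r A}

/-- `C` is a maximal chain in the family `S`, ordered by inclusion. -/
def IsMaxChainIn {X : Type*} (S : Set (Set X)) (C : Set (Set X)) : Prop :=
  C ⊆ S ∧ IsChain (· ⊆ ·) C ∧
    ∀ C' : Set (Set X), C' ⊆ S → IsChain (· ⊆ ·) C' → C ⊆ C' → C' = C

/-- A linear order is complete iff every subset has a supremum and an infimum. -/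
def CompleteLO (L : Type*) [LinearOrder L] : Prop :=
  ∀ S : Set L, (∃ a, IsLUB S a) ∧ (∃ b, IsGLB S b)

/-- `L` embeds into the reals by a strictly increasing map. -/
def REmbeddable (L : Type*) [LinearOrder L] : Prop :=
  ∃ f : L → ℝ, StrictMono f

/-- `L` has a minimum `0_L` which is non-isolated. -/
def BotNonIsolated (L : Type*) [LinearOrder L] : Prop :=
  ∃ z : L, IsBot z ∧ ∀ x, z < x → ∃ y, z < y ∧ y < x

/-- `L` has dense jumps. -/
def DenseJumps (L : Type*) [LinearOrder L] : Prop :=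
  ∀ x y : L, x < y → ∃ a b : L, x ≤ a ∧ a < b ∧ b ≤ y ∧ ∀ c, ¬ (a < c ∧ c < b)

/-- A linear order is Boolean iff it is complete and has dense jumps. -/
def BooleanLO (L : Type*) [LinearOrder L] : Prop :=
  CompleteLO L ∧ DenseJumps L

/-- Every isomorphism between finite suborders of `⟨X,r⟩` extends to an automorphism
of `⟨X,r⟩`. -/
def UltrahomogeneousRel {X : Type*} (r : X → X → Prop) : Prop :=
  ∀ (A : Set X) (f : X → X), A.Finite → Set.InjOn f A →
    (∀ x ∈ A, ∀ y ∈ A, (r x y ↔ r (f x) (f y))) →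
    ∃ g : X ≃ X, (∀ x y, r x y ↔ r (g x) (g y)) ∧ ∀ x ∈ A, g x = f x

/-- `⟨D,r⟩` is a strict partial order with the extension property defining the
countable random poset. -/
def IsRandomPosetRel {D : Type*} (r : D → D → Prop) : Prop :=
  (∀ x, ¬ r x x) ∧ (∀ x y z, r x y → r y z → r x z) ∧
    ∀ L G U : Finset D, Disjoint L G → Disjoint L U → Disjoint G U →
      (∀ l ∈ L, ∀ g ∈ G, r l g) →
      (∀ u ∈ U, ∀ l ∈ L, ¬ r u l) →
      (∀ u ∈ U, ∀ g ∈ G, ¬ r g u) →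
      ∃ p : D, p ∉ L ∧ p ∉ G ∧ p ∉ U ∧ (∀ l ∈ L, r l p) ∧ (∀ g ∈ G, r p g) ∧
        ∀ u ∈ U, p ≠ u ∧ ¬ r p u ∧ ¬ r u p

/-- A positive family of subsets of `D`. -/
def IsPositiveFamily {D : Type*} (P : Set (Set D)) : Prop :=
  ∅ ∉ P ∧ (∀ A B : Set D, A ∈ P → A ⊆ B → B ∈ P) ∧
    (∀ A ∈ P, ∀ F : Set D, F.Finite → A \ F ∈ P) ∧
    ∃ A ∈ P, Aᶜ.Infinite

/-- Isomorphism of binary relational structures. -/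
def RelIsoRel {X Y : Type*} (r : X → X → Prop) (s : Y → Y → Prop) : Prop :=
  ∃ e : X ≃ Y, ∀ x y, r x y ↔ s (e x) (e y)


/-- Generic sequences of finite conditions (Rasiowa-Sikorski). -/
theorem generic_seq {Z ι : Type*} [Countable ι] (Good : Finset Z → Prop) (h0 : Good ∅)
    (D : ι → Finset Z → Prop) (hD : ∀ i F, Good F → ∃ F', F ⊆ F' ∧ Good F' ∧ D i F') :
    ∃ s : ℕ → Finset Z, Monotone s ∧ (∀ n, Good (s n)) ∧ ∀ i, ∃ n, D i (s n) := by
  classical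
  cases nonempty_encodable ι
  let P := {F : Finset Z // Good F}
  let 𝒟 : ι → Order.Cofinal P := fun i =>
    { carrier := {F | D i F.1}
      isCofinal := fun F => by
        obtain ⟨F', h1, h2, h3⟩ := hD i F.1 F.2
        exact ⟨⟨F', h2⟩, h3, h1⟩ }
  let p : P := ⟨∅, h0⟩
  refine ⟨fun n => (Order.sequenceOfCofinals p 𝒟 n).1, ?_, fun n => (Order.sequenceOfCofinals p 𝒟 n).2, ?_⟩
  · intro a b hab
    exact Order.sequenceOfCofinals.monotone p 𝒟 hab
  · intro i
    exact ⟨_, Order.sequenceOfCofinals.encode_mem p 𝒟 i⟩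

/-- Finite partial isomorphism given by its graph. -/
def PIso {X : Type*} (r : X → X → Prop) (F : Set (X × X)) : Prop :=
  ∀ p ∈ F, ∀ q ∈ F, (p.1 = q.1 ↔ p.2 = q.2) ∧ (r p.1 q.1 ↔ r p.2 q.2)

theorem exists_aut {X : Type*} {r : X → X → Prop} (hu : UltrahomogeneousRel r)
    {F : Set (X × X)} (hF : F.Finite) (h : PIso r F) :
    ∃ g : X ≃ X, (∀ x y, r x y ↔ r (g x) (g y)) ∧ ∀ p ∈ F, g p.1 = p.2 := by
  classical
  have hex : ∀ x, ∃ y, ∀ p ∈ F, p.1 = x → p.2 = y := by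
    intro x
    by_cases hx : ∃ p ∈ F, p.1 = x
    · obtain ⟨p, hp, rfl⟩ := hx
      exact ⟨p.2, fun q hq e => ((h q hq p hp).1).1 e⟩
    · exact ⟨x, fun p hp e => (hx ⟨p, hp, e⟩).elim⟩
  choose f hf using hex
  have hf' : ∀ p ∈ F, f p.1 = p.2 := fun p hp => (hf _ p hp rfl).symm
  obtain ⟨g, hg1, hg2⟩ := hu (Prod.fst '' F) f (hF.image _) (by
    rintro _ ⟨p, hp, rfl⟩ _ ⟨q, hq, rfl⟩ e
    rw [hf' p hp, hf' q hq] at e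
    exact ((h p hp q hq).1).2 e) (by
    rintro _ ⟨p, hp, rfl⟩ _ ⟨q, hq, rfl⟩
    rw [hf' p hp, hf' q hq]
    exact (h p hp q hq).2)
  exact ⟨g, hg1, fun p hp => by rw [hg2 _ ⟨p, hp, rfl⟩, hf' p hp]⟩

/-- `y` and `y'` have the same relations to the elements of `A`. -/
def SameType {X : Type*} (r : X → X → Prop) (A : Set X) (y y' : X) : Prop :=
  ∀ a ∈ A, (r a y ↔ r a y') ∧ (r y a ↔ r y' a)

/-- `B` has the one point extension property inside `X`. -/
def ExtSet {X : Type*} (r : X → X → Prop) (B : Set X) : Prop :=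
  ∀ A : Set X, A.Finite → A ⊆ B → ∀ y, y ∉ A → ∃ y' ∈ B, y' ∉ A ∧ SameType r A y y'

theorem copy_of_ext {X : Type*} [Countable X] {r : X → X → Prop} (hirr : ∀ x, ¬ r x x)
    (hu : UltrahomogeneousRel r)
    {B : Set X} (hB : ExtSet r B) : IsCopy r B := by
  classical
  let Good : Finset (X × X) → Prop := fun F => PIso r (F : Set (X × X)) ∧ ∀ p ∈ F, p.2 ∈ B
  let D : X ⊕ X → Finset (X × X) → Prop := fun i F =>
    Sum.rec (fun x => ∃ b, (x, b) ∈ F) (fun b => b ∈ B → ∃ a, (a, b) ∈ F) i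
  have key : ∀ (F : Finset (X × X)) (x b : X), Good F → b ∈ B →
      (∀ p ∈ F, p.1 ≠ x) → (∀ p ∈ F, p.2 ≠ b) →
      (∀ p ∈ F, (r p.1 x ↔ r p.2 b) ∧ (r x p.1 ↔ r b p.2)) → Good (insert (x, b) F) := by
    intro F x b hF hb h1 h2 h3
    refine ⟨?_, ?_⟩
    · intro p hp q hq
      simp only [Finset.coe_insert, Set.mem_insert_iff, Finset.mem_coe] at hp hq
      rcases hp with rfl | hp <;> rcases hq with rfl | hq
      · simp [hirr]
      · exact ⟨⟨fun e => (h1 q hq e.symm).elim, fun e => (h2 q hq e.symm).elim⟩, (h3 q hq).2⟩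
      · exact ⟨⟨fun e => (h1 p hp e).elim, fun e => (h2 p hp e).elim⟩, (h3 p hp).1⟩
      · exact hF.1 p hp q hq
    · intro p hp
      rcases Finset.mem_insert.1 hp with rfl | hp
      · exact hb
      · exact hF.2 p hp
  obtain ⟨s, hs1, hs2, hs3⟩ := generic_seq Good (by simp [Good, PIso]) D (by
    intro i F hF
    obtain ⟨g, hg1, hg2⟩ := exists_aut hu F.finite_toSet hF.1
    rcases i with x | b
    · by_cases hx : ∃ b, (x, b) ∈ F
      · exact ⟨F, subset_rfl, hF, hx⟩
      have hx' : ∀ p ∈ F, p.1 ≠ x := by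
        rintro ⟨a, b⟩ hp rfl; exact hx ⟨b, hp⟩
      obtain ⟨y', hy1, hy2, hy3⟩ := hB (Prod.snd '' (F : Set (X × X))) (F.finite_toSet.image _)
        (by rintro _ ⟨p, hp, rfl⟩; exact hF.2 p hp) (g x) (by
          rintro ⟨p, hp, e⟩
          rw [← hg2 p hp] at e
          exact hx' p hp (g.injective e))
      refine ⟨insert (x, y') F, Finset.subset_insert _ _, key F x y' hF hy1 hx' ?_ ?_,
        ⟨y', Finset.mem_insert_self _ _⟩⟩
      · rintro p hp rfl; exact hy2 ⟨p, hp, rfl⟩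
      · intro p hp
        have := hy3 p.2 ⟨p, hp, rfl⟩
        rw [hg1 p.1 x, hg1 x p.1, hg2 p hp]
        exact this
    · by_cases hb : b ∈ B ∧ ¬ ∃ a, (a, b) ∈ F
      · have hb' : ∀ p ∈ F, p.2 ≠ b := by
          rintro ⟨a, b⟩ hp rfl; exact hb.2 ⟨a, hp⟩
        refine ⟨insert (g.symm b, b) F, Finset.subset_insert _ _, key F _ b hF hb.1 ?_ hb' ?_,
          fun _ => ⟨_, Finset.mem_insert_self _ _⟩⟩
        · intro p hp e
          apply hb' p hp
          rw [← hg2 p hp, e, g.apply_symm_apply]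
        · intro p hp
          rw [hg1 p.1, hg1 _ p.1, hg2 p hp, g.apply_symm_apply]
          exact ⟨Iff.rfl, Iff.rfl⟩
      · refine ⟨F, subset_rfl, hF, fun h => ?_⟩
        by_contra h'
        exact hb ⟨h, h'⟩)
  have hdef : ∀ x, ∃ b, ∃ n, (x, b) ∈ s n := by
    intro x
    obtain ⟨n, b, h⟩ := hs3 (Sum.inl x)
    exact ⟨b, n, h⟩
  choose f nf hf using hdef
  have hcomp : ∀ p q : X × X, (∃ n, p ∈ s n) → (∃ n, q ∈ s n) →
      (p.1 = q.1 ↔ p.2 = q.2) ∧ (r p.1 q.1 ↔ r p.2 q.2) := by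
    rintro p q ⟨n, hn⟩ ⟨m, hm⟩
    exact (hs2 (max n m)).1 p (hs1 (le_max_left n m) hn) q (hs1 (le_max_right n m) hm)
  refine ⟨f, ?_, ?_, ?_⟩
  · intro x y e
    exact (hcomp (x, f x) (y, f y) ⟨_, hf x⟩ ⟨_, hf y⟩).1.2 e
  · apply Set.Subset.antisymm
    · rintro _ ⟨x, rfl⟩
      exact (hs2 _).2 _ (hf x)
    · intro b hb
      obtain ⟨n, h⟩ := hs3 (Sum.inr b)
      obtain ⟨a, ha⟩ := h hb
      exact ⟨a, (hcomp (a, f a) (a, b) ⟨_, hf a⟩ ⟨_, ha⟩).1.1 rfl⟩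
  · intro x y
    exact (hcomp (x, f x) (y, f y) ⟨_, hf x⟩ ⟨_, hf y⟩).2

theorem ext_of_copy {X : Type*} {r : X → X → Prop}
    (hu : UltrahomogeneousRel r) {B : Set X} (hB : IsCopy r B) : ExtSet r B := by
  obtain ⟨f, hf1, rfl, hf3⟩ := hB
  intro A hA hAB y hy
  obtain ⟨g, hg1, hg2⟩ := hu (f ⁻¹' A) f (hA.preimage hf1.injOn) hf1.injOn
    (fun x _ y _ => hf3 x y)
  refine ⟨f (g.symm y), ⟨_, rfl⟩, ?_, ?_⟩
  · intro h
    have := hg2 _ h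
    rw [g.apply_symm_apply] at this
    exact hy (this ▸ h)
  · intro a ha
    obtain ⟨z, rfl⟩ := hAB ha
    rw [← hf3, ← hf3, ← hg2 z ha]
    rw [hg1 z (g.symm y), hg1 (g.symm y) z, g.apply_symm_apply]
    exact ⟨Iff.rfl, Iff.rfl⟩

theorem copy_univ {X : Type*} (r : X → X → Prop) : IsCopy r (Set.univ : Set X) :=
  ⟨id, Function.injective_id, by simp, fun _ _ => Iff.rfl⟩

theorem copy_sUnion {X : Type*} [Countable X] {r : X → X → Prop} (hirr : ∀ x, ¬ r x x)
    (hu : UltrahomogeneousRel r) {S : Set (Set X)} (hne : S.Nonempty)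
    (hch : IsChain (· ⊆ ·) S) (hS : ∀ A ∈ S, IsCopy r A) : IsCopy r (⋃₀ S) := by
  apply copy_of_ext hirr hu
  intro A hA hAS y hy
  obtain ⟨B, hB, hAB⟩ : ∃ B ∈ S, A ⊆ B := by
    induction A, hA using Set.Finite.induction_on with
    | empty => obtain ⟨B, hB⟩ := hne; exact ⟨B, hB, by simp⟩
    | @insert a s _ _ ih =>
      obtain ⟨B, hB, hsB⟩ := ih ((Set.subset_insert _ _).trans hAS) (fun h => hy (Set.mem_insert_of_mem _ h))
      obtain ⟨B', hB', haB'⟩ := hAS (Set.mem_insert a s)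
      rcases hch.total hB hB' with h | h
      · exact ⟨B', hB', Set.insert_subset haB' (hsB.trans h)⟩
      · exact ⟨B, hB, Set.insert_subset (h haB') hsB⟩
  obtain ⟨y', h1, h2, h3⟩ := ext_of_copy hu (hS B hB) A hA hAB y hy
  exact ⟨y', ⟨B, hB, h1⟩, h2, h3⟩

theorem copy_trans {X : Type*} {r : X → X → Prop} {f : X → X} (hf : Function.Injective f)
    (hr : ∀ x y, r x y ↔ r (f x) (f y)) {B : Set X} (hB : IsCopy r B) : IsCopy r (f '' B) := by
  obtain ⟨g, hg1, rfl, hg3⟩ := hB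
  exact ⟨f ∘ g, hf.comp hg1, by rw [Set.range_comp], fun x y => (hg3 x y).trans (hr _ _)⟩


theorem compactSpace_of_lub {L : Type*} [LinearOrder L] [TopologicalSpace L] [OrderTopology L]
    (h : ∀ S : Set L, ∃ a, IsLUB S a) : CompactSpace L := by
  classical
  choose sup hsup using h
  have hinf : ∀ S : Set L, IsGLB S (sup (lowerBounds S)) := fun S =>
    ⟨fun x hx => (hsup (lowerBounds S)).2 (fun y hy => hy hx), fun y hy => (hsup (lowerBounds S)).1 hy⟩
  let I : ConditionallyCompleteLinearOrder L :=
    { (inferInstance : LinearOrder L), (LinearOrder.toLattice : Lattice L) with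
      sSup := sup
      sInf := fun S => sup (lowerBounds S)
      isLUB_csSup := fun s _ _ => hsup s
      isGLB_csInf := fun s _ _ => hinf s
      csSup_of_not_bddAbove := fun s hs => (hs ⟨_, (hsup s).1⟩).elim
      csInf_of_not_bddBelow := fun s hs => (hs ⟨_, (hinf s).1⟩).elim }
  refine ⟨?_⟩
  have h1 : (Set.univ : Set L) = Set.Icc (sup ∅) (sup Set.univ) := by
    ext x
    simp only [Set.mem_univ, Set.mem_Icc, true_iff]
    exact ⟨(hsup ∅).2 (by simp), (hsup univ).1 (mem_univ x)⟩
  rw [h1]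
  exact isCompact_Icc

/-- Urysohn type function for a jump. -/
theorem sep_jump {L : Type*} [LinearOrder L] [TopologicalSpace L] [OrderTopology L]
    {a b : L} (hab : a < b) (hj : ∀ c, ¬ (a < c ∧ c < b)) :
    ∃ u : L → ℝ, Continuous u ∧ Monotone u ∧ (∀ x, 0 ≤ u x ∧ u x ≤ 1) ∧ u a < u b := by
  classical
  have hs : Set.Ici b = Set.Ioi a := by
    ext x
    simp only [mem_Ici, mem_Ioi]
    exact ⟨fun h => hab.trans_le h, fun h => by
      by_contra h'
      exact hj x ⟨h, not_le.1 h'⟩⟩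
  have hcl : IsClopen (Set.Ici b) := ⟨isClosed_Ici, hs ▸ isOpen_Ioi⟩
  refine ⟨fun x => if x ∈ Set.Ici b then 1 else 0, ?_, ?_, ?_, ?_⟩
  · refine continuous_const.if ?_ continuous_const
    intro x hx
    have : frontier {x | x ∈ Set.Ici b} = ∅ := hcl.frontier_eq
    rw [this] at hx
    exact hx.elim
  · intro x y hxy
    simp only [mem_Ici]
    split_ifs with h1 h2 <;> norm_num
    exact h2 (h1.trans hxy)
  · intro x; dsimp only; split_ifs <;> norm_num
  · simp [hab.not_ge]

/-- Urysohn type function for a densely ordered interval. -/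
theorem sep_dense {L : Type*} [LinearOrder L] [TopologicalSpace L] [OrderTopology L]
    {D : Set L} (hD : D.Countable) {a b : L} (hab : a < b)
    (hd : ∀ x y, a ≤ x → x < y → y ≤ b → ∃ d ∈ D, x < d ∧ d < y) :
    ∃ u : L → ℝ, Continuous u ∧ Monotone u ∧ (∀ x, 0 ≤ u x ∧ u x ≤ 1) ∧ u a < u b := by
  classical
  let S : Set L := D ∩ Ioo a b
  have : Countable S := (hD.mono inter_subset_left).to_subtype
  have : Nonempty S := by
    obtain ⟨d, h1, h2⟩ := hd a b le_rfl hab le_rfl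
    exact ⟨d, h1, h2⟩
  have : DenselyOrdered S := ⟨fun x y hxy => by
    obtain ⟨d, h1, h2, h3⟩ := hd x.1 y.1 x.2.2.1.le hxy y.2.2.2.le
    exact ⟨⟨d, h1, x.2.2.1.trans h2, h3.trans y.2.2.2⟩, h2, h3⟩⟩
  have : NoMinOrder S := ⟨fun x => by
    obtain ⟨d, h1, h2, h3⟩ := hd a x.1 le_rfl x.2.2.1 x.2.2.2.le
    exact ⟨⟨d, h1, h2, h3.trans x.2.2.2⟩, h3⟩⟩
  have : NoMaxOrder S := ⟨fun x => by
    obtain ⟨d, h1, h2, h3⟩ := hd x.1 b x.2.2.1.le x.2.2.2 le_rfl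
    exact ⟨⟨d, h1, x.2.2.1.trans h2, h3⟩, h2⟩⟩
  have : Nonempty (Ioo (0:ℚ) 1) := ⟨⟨1/2, by norm_num, by norm_num⟩⟩
  obtain ⟨ψ⟩ := Order.iso_of_countable_dense S (Ioo (0:ℚ) 1)
  let T : L → Set ℝ := fun x => insert 0 {y | ∃ s : S, s.1 ≤ x ∧ y = ((ψ s).1 : ℝ)}
  have hT1 : ∀ x, ∀ y ∈ T x, y ≤ 1 := by
    rintro x y (rfl | ⟨s, _, rfl⟩)
    · norm_num
    · exact_mod_cast (ψ s).2.2.le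
  have hbd : ∀ x, BddAbove (T x) := fun x => ⟨1, hT1 x⟩
  have hne : ∀ x, (T x).Nonempty := fun x => ⟨0, Or.inl rfl⟩
  let u : L → ℝ := fun x => sSup (T x)
  have hu0 : ∀ x, 0 ≤ u x := fun x => le_csSup (hbd x) (Or.inl rfl)
  have hu1 : ∀ x, u x ≤ 1 := fun x => csSup_le (hne x) (hT1 x)
  have hmono : Monotone u := by
    intro x y hxy
    apply csSup_le_csSup (hbd y) (hne x)
    rintro z (rfl | ⟨s, h, rfl⟩)
    · exact Or.inl rfl
    · exact Or.inr ⟨s, h.trans hxy, rfl⟩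
  have hval : ∀ s : S, u s.1 = ((ψ s).1 : ℝ) := by
    intro s
    apply le_antisymm
    · apply csSup_le (hne _)
      rintro z (rfl | ⟨s', h, rfl⟩)
      · exact_mod_cast (ψ s).2.1.le
      · have : ψ s' ≤ ψ s := ψ.monotone h
        exact_mod_cast this
    · exact le_csSup (hbd _) (Or.inr ⟨s, le_rfl, rfl⟩)
  have hua : u a = 0 := by
    apply le_antisymm _ (hu0 a)
    apply csSup_le (hne _)
    rintro z (rfl | ⟨s', h, rfl⟩)
    · exact le_rfl
    · exact absurd s'.2.2.1 (not_lt.2 h)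
  let v : L → Icc (0:ℝ) 1 := fun x => ⟨u x, hu0 x, hu1 x⟩
  have hvm : Monotone v := fun x y h => hmono h
  have hvd : DenseRange v := by
    apply dense_of_exists_between
    intro p q hpq
    obtain ⟨c, hc1, hc2⟩ := exists_rat_btwn (show p.1 < q.1 from hpq)
    have hc : c ∈ Ioo (0:ℚ) 1 := by
      constructor
      · exact_mod_cast p.2.1.trans_lt hc1
      · exact_mod_cast hc2.trans_le q.2.2
    refine ⟨v (ψ.symm ⟨c, hc⟩).1, ⟨_, rfl⟩, ?_⟩
    have := hval (ψ.symm ⟨c, hc⟩)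
    rw [ψ.apply_symm_apply] at this
    constructor
    · show p.1 < u _
      rw [this]; exact hc1
    · show u _ < q.1
      rw [this]; exact hc2
  have hvc : Continuous v := hvm.continuous_of_denseRange hvd
  refine ⟨u, continuous_subtype_val.comp hvc, hmono, fun x => ⟨hu0 x, hu1 x⟩, ?_⟩
  obtain ⟨s⟩ := (inferInstance : Nonempty S)
  calc u a = 0 := hua
    _ < ((ψ s).1 : ℝ) := by exact_mod_cast (ψ s).2.1
    _ = u s.1 := (hval s).symm
    _ ≤ u b := hmono s.2.2.2.le

theorem exists_countable_sep {L : Type*} [LinearOrder L] (f : L → ℝ) (hf : StrictMono f) :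
    ∃ D : Set L, D.Countable ∧ (∀ x y, x < y → (∀ c, ¬ (x < c ∧ c < y)) → x ∈ D ∧ y ∈ D) ∧
      ∀ x y z w v : L, x < y → y < z → z < w → w < v → ∃ d ∈ D, x < d ∧ d < v := by
  classical
  let D1 : Set L := ⋃ p : ℚ × ℚ, if h : ∃ x, (p.1 : ℝ) < f x ∧ f x < p.2 then {h.choose} else ∅
  let J : Set (L × L) := {p | p.1 < p.2 ∧ ∀ c, ¬ (p.1 < c ∧ c < p.2)}
  have hJ : J.Countable := by
    have hex : ∀ p : J, ∃ q : ℚ, f p.1.1 < q ∧ (q : ℝ) < f p.1.2 := fun p =>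
      exists_rat_btwn (hf p.2.1)
    choose q hq1 hq2 using hex
    have hle : ∀ p p' : J, q p = q p' → p.1.1 ≤ p'.1.1 ∧ p'.1.2 ≤ p.1.2 := by
      intro p p' e
      have h1 : f p.1.1 < f p'.1.2 := by
        have := hq2 p'; rw [← e] at this; exact (hq1 p).trans this
      have h1' : p.1.1 < p'.1.2 := hf.lt_iff_lt.1 h1
      have h2 : f p'.1.1 < f p.1.2 := by
        have := hq2 p; rw [e] at this; exact (hq1 p').trans this
      have h2' : p'.1.1 < p.1.2 := hf.lt_iff_lt.1 h2
      constructor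
      · by_contra h
        exact p'.2.2 _ ⟨not_le.1 h, h1'⟩
      · by_contra h
        exact p'.2.2 _ ⟨h2', not_le.1 h⟩
    have hinj : Function.Injective q := by
      intro p p' e
      obtain ⟨h1, h2⟩ := hle p p' e
      obtain ⟨h3, h4⟩ := hle p' p e.symm
      exact Subtype.ext (Prod.ext (le_antisymm h1 h3) (le_antisymm h4 h2))
    exact Set.countable_coe_iff.1 hinj.countable
  refine ⟨D1 ∪ (Prod.fst '' J ∪ Prod.snd '' J), ?_, ?_, ?_⟩
  · refine (Set.countable_iUnion fun p => ?_).union ((hJ.image _).union (hJ.image _))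
    split_ifs
    · exact Set.countable_singleton _
    · exact Set.countable_empty
  · intro x y hxy hj
    exact ⟨Or.inr (Or.inl ⟨(x, y), ⟨hxy, hj⟩, rfl⟩), Or.inr (Or.inr ⟨(x, y), ⟨hxy, hj⟩, rfl⟩)⟩
  · intro x y z w v hxy hyz hzw hwv
    obtain ⟨p, hp1, hp2⟩ := exists_rat_btwn (hf hyz)
    obtain ⟨q, hq1, hq2⟩ := exists_rat_btwn (hf hzw)
    have hex : ∃ x, (p : ℝ) < f x ∧ f x < q := ⟨z, hp2, hq1⟩
    refine ⟨hex.choose, Or.inl (Set.mem_iUnion.2 ⟨(p, q), ?_⟩), ?_, ?_⟩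
    · simp only [hex, dite_true]
      simp
    · exact hxy.trans (hf.lt_iff_lt.1 (hp1.trans hex.choose_spec.1))
    · exact (hf.lt_iff_lt.1 (hex.choose_spec.2.trans hq2)).trans hwv

theorem iso_compact {L : Type*} [LinearOrder L] (hlub : ∀ S : Set L, ∃ a, IsLUB S a)
    (f : L → ℝ) (hf : StrictMono f) : ∃ K : Set ℝ, IsCompact K ∧ Nonempty (L ≃o K) := by
  classical
  let _ : TopologicalSpace L := Preorder.topology L
  have : OrderTopology L := ⟨rfl⟩
  have := compactSpace_of_lub hlub
  obtain ⟨D, hD, hDj, hDd⟩ := exists_countable_sep f hf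
  let Q : L × L → (L → ℝ) → Prop := fun p u =>
    Continuous u ∧ Monotone u ∧ (∀ x, 0 ≤ u x ∧ u x ≤ 1) ∧ u p.1 < u p.2
  let P : Set (L × L) := {p | p ∈ D ×ˢ D ∧ ∃ u, Q p u}
  have hP : P.Countable := (hD.prod hD).mono (fun p hp => hp.1)
  have hsep : ∀ x y, x < y → ∃ p ∈ P, x ≤ p.1 ∧ p.2 ≤ y := by
    intro x y hxy
    by_cases hj : ∃ a b, x ≤ a ∧ a < b ∧ b ≤ y ∧ ∀ c, ¬ (a < c ∧ c < b)
    · obtain ⟨a, b, h1, h2, h3, h4⟩ := hj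
      exact ⟨(a, b), ⟨⟨(hDj a b h2 h4).1, (hDj a b h2 h4).2⟩, sep_jump h2 h4⟩, h1, h3⟩
    · have hb : ∀ a b, x ≤ a → a < b → b ≤ y → ∃ c, a < c ∧ c < b := by
        intro a b h1 h2 h3
        by_contra h
        exact hj ⟨a, b, h1, h2, h3, fun c hc => h ⟨c, hc⟩⟩
      have hd : ∀ a b, x ≤ a → a < b → b ≤ y → ∃ c ∈ D, a < c ∧ c < b := by
        intro a b h1 h2 h3
        obtain ⟨c, hc1, hc2⟩ := hb a b h1 h2 h3
        obtain ⟨c', hc1', hc2'⟩ := hb a c h1 hc1 (hc2.le.trans h3)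
        obtain ⟨c'', hc1'', hc2''⟩ := hb c b (h1.trans hc1.le) hc2 h3
        exact hDd a c' c c'' b hc1' hc2' hc1'' hc2''
      obtain ⟨c, hcD, hc1, hc2⟩ := hd x y le_rfl hxy le_rfl
      obtain ⟨d, hdD, hd1, hd2⟩ := hd c y hc1.le hc2 le_rfl
      exact ⟨(c, d), ⟨⟨hcD, hdD⟩, sep_dense hD hd1 (fun a b h1 h2 h3 =>
        hd a b (hc1.le.trans h1) h2 (h3.trans hd2.le))⟩, hc1.le, hd2.le⟩
  have : Countable P := hP.to_subtype
  cases nonempty_encodable P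
  choose u hu using fun p : P => p.2.2
  let w : P → ℝ := fun p => (1 / 2 : ℝ) ^ Encodable.encode p
  have hw : Summable w := summable_geometric_two_encode
  have hw0 : ∀ p, 0 < w p := fun p => by positivity
  have hbound : ∀ p x, ‖w p * u p x‖ ≤ w p := by
    intro p x
    rw [Real.norm_eq_abs, abs_of_nonneg (mul_nonneg (hw0 p).le ((hu p).2.2.1 x).1)]
    exact mul_le_of_le_one_right (hw0 p).le ((hu p).2.2.1 x).2
  let g : L → ℝ := fun x => ∑' p, w p * u p x
  have hgc : Continuous g := continuous_tsum (fun p => continuous_const.mul (hu p).1) hw hbound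
  have hsum : ∀ x, Summable fun p => w p * u p x := fun x =>
    Summable.of_norm_bounded hw (fun p => hbound p x)
  have hgm : StrictMono g := by
    intro x y hxy
    obtain ⟨p, hp, h1, h2⟩ := hsep x y hxy
    refine Summable.tsum_lt_tsum (i := ⟨p, hp⟩) (fun q => ?_) ?_ (hsum x) (hsum y)
    · exact mul_le_mul_of_nonneg_left ((hu q).2.1 hxy.le) (hw0 q).le
    · exact mul_lt_mul_of_pos_left (((hu ⟨p, hp⟩).2.1 h1).trans_lt
        ((hu ⟨p, hp⟩).2.2.2.trans_le ((hu ⟨p, hp⟩).2.1 h2))) (hw0 _)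
  exact ⟨Set.range g, isCompact_range hgc, ⟨hgm.orderIso g⟩⟩


theorem forward_dir {X : Type*} [Countable X] [Infinite X] {r : X → X → Prop}
    (hirr : ∀ x, ¬ r x x) (hu : UltrahomogeneousRel r)
    (hprop : ∃ A, IsCopy r A ∧ A ≠ univ) {C : Set (Set X)}
    (hC : IsMaxChainIn (Copies r ∪ {∅}) C) {L : Type*} [LinearOrder L] (e : L ≃o ↥C) :
    ∃ K : Set ℝ, IsCompact K ∧ (∃ m, IsLeast K m ∧ AccPt m (Filter.principal K)) ∧
        Nonempty (L ≃o ↥K) := by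
  classical
  obtain ⟨hCS, hch, hmax⟩ := hC
  have hcne : ∀ A, IsCopy r A → A.Nonempty := by
    rintro _ ⟨f, _, rfl, _⟩
    exact Set.range_nonempty f
  have hmem : ∀ B, B ∈ Copies r ∪ {∅} → (∀ A ∈ C, B ⊆ A ∨ A ⊆ B) → B ∈ C := by
    intro B hB hcomp
    have h1 : IsChain (· ⊆ ·) (insert B C) := hch.insert (fun A hA _ => hcomp A hA)
    have := hmax (insert B C) (Set.insert_subset hB hCS) h1 (Set.subset_insert _ _)
    rw [← this]
    exact Set.mem_insert _ _
  have hempty : ∅ ∈ C := hmem ∅ (Or.inr rfl) (fun A _ => Or.inl (Set.empty_subset A))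
  have huniv : univ ∈ C := hmem univ (Or.inl (copy_univ r)) (fun A _ => Or.inr (Set.subset_univ A))
  have hunion : ∀ S ⊆ C, ⋃₀ S ∈ C := by
    intro S hS
    apply hmem
    · by_cases hne : ∃ A ∈ S, A ≠ ∅
      · left
        have : ⋃₀ S = ⋃₀ {A ∈ S | A ≠ ∅} := by
          ext x
          constructor
          · rintro ⟨A, hA, hx⟩
            exact ⟨A, ⟨hA, fun h => by rw [h] at hx; exact hx⟩, hx⟩
          · rintro ⟨A, hA, hx⟩
            exact ⟨A, hA.1, hx⟩
        rw [this]
        obtain ⟨A, hA, hA'⟩ := hne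
        refine copy_sUnion hirr hu ⟨A, hA, hA'⟩ (hch.mono fun A hA => hS hA.1) ?_
        rintro A ⟨hA, hA'⟩
        rcases hCS (hS hA) with h | h
        · exact h
        · exact (hA' h).elim
      · right
        push Not at hne
        simp only [mem_singleton_iff, sUnion_eq_empty]
        exact hne
    · intro A hA
      by_cases h : ∃ B ∈ S, A ⊆ B
      · obtain ⟨B, hB, hAB⟩ := h
        exact Or.inr (hAB.trans (Set.subset_sUnion_of_mem hB))
      · left
        apply Set.sUnion_subset
        intro B hB
        rcases hch.total (hS hB) hA with h' | h'
        · exact h'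
        · exact (h ⟨B, hB, h'⟩).elim
  have hlub : ∀ S : Set L, ∃ a, IsLUB S a := by
    intro S
    let U : C := ⟨⋃₀ ((fun x => (e x).1) '' S), hunion _ (by rintro _ ⟨x, _, rfl⟩; exact (e x).2)⟩
    refine ⟨e.symm U, ?_, ?_⟩
    · intro x hx
      rw [OrderIso.le_symm_apply]
      exact Set.subset_sUnion_of_mem (show (e x).1 ∈ _ from ⟨x, hx, rfl⟩)
    · intro y hy
      rw [OrderIso.symm_apply_le]
      apply Set.sUnion_subset
      rintro _ ⟨x, hx, rfl⟩
      exact e.monotone (hy hx)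
  obtain ⟨f, hf⟩ : ∃ f : L → ℝ, StrictMono f := by
    cases nonempty_encodable X
    let w : X → ℝ := fun p => (1 / 2 : ℝ) ^ Encodable.encode p
    have hw : Summable w := summable_geometric_two_encode
    have hw0 : ∀ p, 0 < w p := fun p => by positivity
    have hs : ∀ A : Set X, Summable (A.indicator w) := fun A => hw.indicator A
    refine ⟨fun x => ∑' p, (e x).1.indicator w p, fun x y hxy => ?_⟩
    have hlt : (e x).1 ⊂ (e y).1 := by
      have : e x < e y := e.strictMono hxy
      exact this
    obtain ⟨p, hp1, hp2⟩ := Set.exists_of_ssubset hlt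
    refine Summable.tsum_lt_tsum (i := p) (fun q => ?_) ?_ (hs _) (hs _)
    · exact Set.indicator_le_indicator_of_subset hlt.1 (fun a => (hw0 a).le) q
    · rw [Set.indicator_of_notMem hp2, Set.indicator_of_mem hp1]
      exact hw0 p
  obtain ⟨K, hK, ⟨φ⟩⟩ := iso_compact hlub f hf
  let z : L := e.symm ⟨∅, hempty⟩
  let t : L := e.symm ⟨univ, huniv⟩
  have hz : ∀ x, z ≤ x := by
    intro x
    rw [OrderIso.symm_apply_le]
    exact Set.empty_subset _
  have hzt : z < t := by
    apply lt_of_le_of_ne (hz t)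
    intro h
    have := e.symm.injective h
    have h2 : (∅ : Set X) = univ := congrArg Subtype.val this
    exact Set.empty_ne_univ h2
  have hleast : IsLeast K (φ z).1 := by
    refine ⟨(φ z).2, fun k hk => ?_⟩
    have : φ z ≤ ⟨k, hk⟩ := by
      rw [← OrderIso.le_symm_apply]; exact hz _
    exact this
  refine ⟨K, hK, ⟨(φ z).1, hleast, ?_⟩, ⟨φ⟩⟩
  rw [accPt_iff_nhds]
  intro U hU
  by_contra hcon
  obtain ⟨ε, hε, hball⟩ := Metric.mem_nhds_iff.1 hU
  have hsep : ∀ k ∈ K, k ≠ (φ z).1 → (φ z).1 + ε ≤ k := by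
    intro k hk hne
    by_contra hlt
    apply hcon
    refine ⟨k, ⟨hball ?_, hk⟩, hne⟩
    have := hleast.2 hk
    rw [Metric.mem_ball, Real.dist_eq, abs_of_nonneg (by linarith)]
    linarith
  have hK1 : IsCompact (K ∩ Set.Ici ((φ z).1 + ε)) := hK.inter_right isClosed_Ici
  have hφt : (φ z).1 < (φ t).1 := φ.strictMono hzt
  obtain ⟨m1, hm1⟩ := hK1.exists_isLeast ⟨(φ t).1, (φ t).2, hsep _ (φ t).2 hφt.ne'⟩
  let y : L := φ.symm ⟨m1, hm1.1.1⟩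
  have hφy : (φ y).1 = m1 := by simp [y]
  have hzy : z < y := by
    apply φ.lt_iff_lt.1
    show (φ z).1 < (φ y).1
    rw [hφy]
    have : (φ z).1 + ε ≤ m1 := hm1.1.2
    linarith
  have hymin : ∀ x, z < x → y ≤ x := by
    intro x hx
    apply φ.le_iff_le.1
    show (φ y).1 ≤ (φ x).1
    rw [hφy]
    have : (φ z).1 < (φ x).1 := φ.strictMono hx
    exact hm1.2 ⟨(φ x).2, hsep _ (φ x).2 this.ne'⟩
  have hyne : (e y).1 ≠ ∅ := by
    intro h
    have : e y = ⟨∅, hempty⟩ := Subtype.ext h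
    have h2 : y = z := by rw [← e.symm_apply_apply y, this]
    exact hzy.ne' h2
  have hycopy : IsCopy r (e y).1 := by
    rcases hCS (e y).2 with h | h
    · exact h
    · exact (hyne h).elim
  obtain ⟨g, hg1, hg2, hg3⟩ := hycopy
  obtain ⟨P, hP, hPne⟩ := hprop
  have hBcopy := copy_trans hg1 hg3 hP
  have hBsub : g '' P ⊆ (e y).1 := by
    rw [← hg2]; exact Set.image_subset_range _ _
  have hmin' : ∀ A ∈ C, A ≠ ∅ → (e y).1 ⊆ A := by
    intro A hA hAne
    have h1 : z < e.symm ⟨A, hA⟩ := by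
      apply lt_of_le_of_ne (hz _)
      intro h
      have := e.symm.injective h
      exact hAne (congrArg Subtype.val this).symm
    have := hymin _ h1
    rw [OrderIso.le_symm_apply] at this
    exact this
  have hBC : g '' P ∈ C := by
    apply hmem _ (Or.inl hBcopy)
    intro A hA
    by_cases hAe : A = ∅
    · right; rw [hAe]; exact Set.empty_subset _
    · left; exact hBsub.trans (hmin' A hA hAe)
  have := hmin' _ hBC (hcne _ hBcopy).ne_empty
  rw [← hg2] at this
  apply hPne
  rw [Set.eq_univ_iff_forall]
  intro x
  obtain ⟨x', hx', hxx⟩ := this ⟨x, rfl⟩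
  rw [← hg1 hxx]
  exact hx'


/-- `a` is the left end of a jump `(a,b)` of `K`. -/
def JumpAt (K : Set ℝ) (a b : ℝ) : Prop :=
  a ∈ K ∧ b ∈ K ∧ a < b ∧ ∀ c ∈ K, a < c → ¬ c < b

theorem chain_lemma {X : Type*} {r : X → X → Prop}
    (hmax : ∀ x, ∃ y, r x y) {K : Set ℝ} (hK : IsCompact K) {m : ℝ} (hm : IsLeast K m)
    (β : X → ℝ) (hβ : ∀ x, β x ∈ K)
    (h1 : ∀ a b, JumpAt K a b → ∀ B, IsCopy r B → {x | β x < a} ⊆ B → B ⊆ {x | β x < b} →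
      B = {x | β x < a} ∨ B = {x | β x < b})
    (h2 : ∀ x y, (¬ ∃ b, JumpAt K (β x) b) → β y ≤ β x → ¬ r x y)
    (h3 : ∀ s ∈ K, ∀ t ∈ K, s < t → ∃ x, s ≤ β x ∧ β x < t)
    (h4 : ∀ t ∈ K, m < t → IsCopy r {x | β x < t}) :
    ∃ C : Set (Set X), IsMaxChainIn (Copies r ∪ {∅}) C ∧ Nonempty (↥K ≃o ↥C) := by
  classical
  let A : ℝ → Set X := fun t => {x | β x < t}
  have hAmono : ∀ s t, s ≤ t → A s ⊆ A t := fun s t h x hx => lt_of_lt_of_le hx h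
  have hAm : A m = ∅ := by
    ext x; simp only [A, mem_ofPred_eq, mem_empty_iff_false, iff_false, not_lt]
    exact hm.2 (hβ x)
  have hAS : ∀ t ∈ K, A t ∈ Copies r ∪ {∅} := by
    intro t ht
    rcases (hm.2 ht).eq_or_lt with h | h
    · right; rw [← h]; exact hAm
    · left; exact h4 t ht h
  have hle : ∀ s ∈ K, ∀ t ∈ K, (A s ⊆ A t ↔ s ≤ t) := by
    intro s hs t ht
    refine ⟨fun h => ?_, hAmono s t⟩
    by_contra hlt
    obtain ⟨x, hx1, hx2⟩ := h3 t ht s hs (not_le.1 hlt)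
    exact absurd (h hx2) (not_lt.2 hx1)
  refine ⟨A '' K, ⟨?_, ?_, ?_⟩, ⟨?_⟩⟩
  · rintro _ ⟨t, ht, rfl⟩; exact hAS t ht
  · rintro _ ⟨t, ht, rfl⟩ _ ⟨s, hs, rfl⟩ _
    rcases le_total t s with h | h
    · exact Or.inl (hAmono _ _ h)
    · exact Or.inr (hAmono _ _ h)
  · intro C' hC'S hC' hsub
    refine Subset.antisymm ?_ hsub
    intro B hB
    have hcomp : ∀ t ∈ K, A t ⊆ B ∨ B ⊆ A t := fun t ht =>
      hC'.total (hsub ⟨t, ht, rfl⟩) hB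
    let T : Set ℝ := {t | t ∈ K ∧ A t ⊆ B}
    have hmT : m ∈ T := ⟨hm.1, by rw [hAm]; exact empty_subset _⟩
    have hTb : BddAbove T := hK.bddAbove.mono (fun t ht => ht.1)
    have hlub := isLUB_csSup ⟨m, hmT⟩ hTb
    set s := sSup T with hs
    have hsK : s ∈ K := by
      have := hlub.mem_closure ⟨m, hmT⟩
      exact hK.isClosed.closure_subset_iff.2 (fun t ht => ht.1) this
    have hAsB : A s ⊆ B := by
      intro x hx
      obtain ⟨t, ht, hxt⟩ := (lt_isLUB_iff hlub).1 hx
      exact ht.2 hxt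
    have hBt : ∀ t ∈ K, s < t → B ⊆ A t := by
      intro t ht hst
      rcases hcomp t ht with h | h
      · exact absurd (hlub.1 ⟨ht, h⟩) (not_le.2 hst)
      · exact h
    rcases hC'S hB with hcopy | hemp
    swap
    · exact ⟨m, hm.1, by rw [hAm]; exact hemp.symm⟩
    by_cases hj : ∃ b, JumpAt K s b
    · obtain ⟨b, hj⟩ := hj
      rcases h1 s b hj B hcopy hAsB (hBt b hj.2.1 hj.2.2.1) with h | h
      · exact ⟨s, hsK, h.symm⟩
      · exact ⟨b, hj.2.1, h.symm⟩
    · have hBle : ∀ x ∈ B, β x ≤ s := by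
        intro x hx
        by_contra h
        exact lt_irrefl (β x) (hBt (β x) (hβ x) (not_le.1 h) hx)
      refine ⟨s, hsK, Subset.antisymm hAsB ?_⟩
      intro x hx
      refine lt_of_le_of_ne (hBle x hx) ?_
      intro he
      obtain ⟨f, hf1, rfl, hf3⟩ := hcopy
      obtain ⟨z, rfl⟩ := hx
      obtain ⟨w, hw⟩ := hmax z
      refine h2 (f z) (f w) (by rw [he]; exact hj) ?_ ((hf3 _ _).1 hw)
      rw [he]; exact hBle _ ⟨w, rfl⟩
  · exact
      { toFun := fun t => ⟨A t.1, t.1, t.2, rfl⟩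
        invFun := fun c => ⟨c.2.choose, c.2.choose_spec.1⟩
        left_inv := by
          intro t
          have h := (⟨t.1, t.2, rfl⟩ : ∃ u, u ∈ K ∧ A u = A t.1).choose_spec
          apply Subtype.ext
          exact le_antisymm ((hle _ h.1 _ t.2).1 h.2.le) ((hle _ t.2 _ h.1).1 h.2.ge)
        right_inv := fun c => Subtype.ext c.2.choose_spec.2
        map_rel_iff' := by
          intro s t
          exact hle _ s.2 _ t.2 }


theorem split_infinite {X ι : Type*} [Countable X] [Countable ι] (S : ι → Set X)
    (hS : ∀ i, (S i).Infinite) :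
    ∃ D : Set X, ∀ i, (S i ∩ D).Infinite ∧ (S i \ D).Infinite := by
  classical
  let Good : Finset (X × Bool) → Prop := fun F => ∀ x, ¬ ((x, true) ∈ F ∧ (x, false) ∈ F)
  let D : ι × Finset X × Bool → Finset (X × Bool) → Prop := fun i F =>
    ∃ x ∈ S i.1, x ∉ i.2.1 ∧ (x, i.2.2) ∈ F
  obtain ⟨s, hs1, hs2, hs3⟩ := generic_seq Good (by simp [Good]) D (by
    rintro ⟨i, E, b⟩ F hF
    obtain ⟨x, hx, hxE⟩ := (hS i).exists_notMem_finset (E ∪ F.image Prod.fst)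
    simp only [Finset.mem_union, Finset.mem_image, not_or, not_exists, not_and] at hxE
    refine ⟨insert (x, b) F, Finset.subset_insert _ _, ?_, x, hx, hxE.1, Finset.mem_insert_self _ _⟩
    intro y hy
    simp only [Finset.mem_insert, Prod.mk.injEq] at hy
    have h1 : ∀ c, (x, c) ∉ F := fun c hc => hxE.2 _ hc rfl
    rcases hy with ⟨⟨rfl, h2⟩ | h2, ⟨h4, h3⟩ | h3⟩
    · rw [← h2] at h3; cases h3
    · exact h1 _ h3
    · subst h4; exact h1 _ h2
    · exact hF y ⟨h2, h3⟩)
  refine ⟨{x | ∃ n, (x, true) ∈ s n}, fun i => ⟨?_, ?_⟩⟩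
  · intro hfin
    obtain ⟨n, x, hx, hxE, hxs⟩ := hs3 (i, hfin.toFinset, true)
    exact hxE (by simp only [Finite.mem_toFinset]; exact ⟨hx, n, hxs⟩)
  · intro hfin
    obtain ⟨n, x, hx, hxE, hxs⟩ := hs3 (i, hfin.toFinset, false)
    refine hxE (by
      simp only [Finite.mem_toFinset]
      refine ⟨hx, ?_⟩
      rintro ⟨k, hk⟩
      exact hs2 (max n k) x ⟨hs1 (le_max_right _ _) hk, hs1 (le_max_left _ _) hxs⟩)

theorem inj_choice {X ι : Type*} [Countable ι] (S : ι → Set X)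
    (hS : ∀ i, (S i).Infinite) : ∃ c : ι → X, Function.Injective c ∧ ∀ i, c i ∈ S i := by
  classical
  let Good : Finset (ι × X) → Prop := fun F => (∀ p ∈ F, p.2 ∈ S p.1) ∧
    ∀ p ∈ F, ∀ q ∈ F, p.2 = q.2 → p.1 = q.1
  let D : ι → Finset (ι × X) → Prop := fun i F => ∃ x, (i, x) ∈ F
  obtain ⟨s, hs1, hs2, hs3⟩ := generic_seq Good (by simp [Good]) D (by
    intro i F hF
    obtain ⟨x, hx, hxE⟩ := (hS i).exists_notMem_finset (F.image Prod.snd)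
    simp only [Finset.mem_image, not_exists, not_and] at hxE
    refine ⟨insert (i, x) F, Finset.subset_insert _ _, ⟨?_, ?_⟩, x, Finset.mem_insert_self _ _⟩
    · intro p hp
      rcases Finset.mem_insert.1 hp with rfl | hp
      · exact hx
      · exact hF.1 p hp
    · intro p hp q hq e
      rcases Finset.mem_insert.1 hp with rfl | hp <;> rcases Finset.mem_insert.1 hq with rfl | hq
      · rfl
      · exact (hxE q hq e.symm).elim
      · exact (hxE p hp e).elim
      · exact hF.2 p hp q hq e)
  choose n c hc using hs3
  refine ⟨c, ?_, fun i => (hs2 _).1 _ (hc i)⟩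
  intro i j e
  exact (hs2 (max (n i) (n j))).2 (i, c i) (hs1 (le_max_left _ _) (hc i)) (j, c j)
    (hs1 (le_max_right _ _) (hc j)) e

/-- A good height function. -/
structure GoodH {X : Type*} (r : X → X → Prop) (h : X → ℚ) : Prop where
  mono : ∀ x y, r x y → h x < h y
  ext : ∀ (A : Finset X) (y : X) (q : ℚ), y ∉ A → (∀ a ∈ A, h a < q) →
    {y' | y' ∉ A ∧ SameType r A y y' ∧ h y' < q}.Infinite
  dense : ∀ p q : ℚ, p < q → ∃ x, p < h x ∧ h x < q

theorem GoodH.split {X : Type*} [Countable X] [Nonempty X] {r : X → X → Prop} {h : X → ℚ}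
    (hg : GoodH r h) : ∃ D : Set X,
    (∀ (A : Finset X) (y : X) (q : ℚ), y ∉ A → (∀ a ∈ A, h a < q) →
    ({y' | y' ∉ A ∧ SameType r A y y' ∧ h y' < q} ∩ D).Infinite) ∧
    (∀ q : ℚ, ({x | h x < q} \ D).Infinite) ∧
    (∀ p q : ℚ, p < q → ∃ x ∈ D, p < h x ∧ h x < q) := by
  classical
  let I1 := {i : Finset X × X × ℚ // i.2.1 ∉ i.1 ∧ ∀ a ∈ i.1, h a < i.2.2}
  let I2 := {i : ℚ × ℚ // i.1 < i.2}
  let S : I1 ⊕ I2 → Set X := fun i => Sum.rec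
    (fun i => {y' | y' ∉ i.1.1 ∧ SameType r i.1.1 i.1.2.1 y' ∧ h y' < i.1.2.2})
    (fun i => {x | i.1.1 < h x ∧ h x < i.1.2}) i
  obtain ⟨D, hD⟩ := split_infinite S (by
    rintro (⟨⟨A, y, q⟩, h1, h2⟩ | ⟨⟨p, q⟩, hpq⟩)
    · exact hg.ext A y q h1 h2
    · intro hfin
      have hfin' : (h '' {x | p < h x ∧ h x < q}).Finite := hfin.image _
      have hpq' : p < q := hpq
      obtain ⟨z, hz⟩ := (Ioo_infinite hpq').exists_notMem_finite hfin'
      obtain ⟨hz1, hz2⟩ := hz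
      have hfin2 : (h '' {x | p < h x ∧ h x < q} ∩ Iio q).Finite := hfin'.inter_of_left _
      obtain ⟨M, hM, hM2⟩ : ∃ M, M < q ∧ ∀ w ∈ (h '' {x | p < h x ∧ h x < q} ∩ Iio q), w ≤ M := by
        rcases (h '' {x | p < h x ∧ h x < q} ∩ Iio q).eq_empty_or_nonempty with h0 | h0
        · exact ⟨z, hz1.2, by rw [h0]; simp⟩
        · obtain ⟨M, hM⟩ := hfin2.exists_maximal h0
          refine ⟨M, hM.1.2, fun w hw => ?_⟩
          rcases le_total w M with h | h
          · exact h
          · exact hM.2 hw h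
      obtain ⟨x, hx1, hx2⟩ := hg.dense (max M p) q (max_lt hM hpq')
      have := hM2 (h x) ⟨⟨x, ⟨(le_max_right _ _).trans_lt hx1, hx2⟩, rfl⟩, hx2⟩
      exact absurd ((le_max_left M p).trans_lt hx1) (not_lt.2 this))
  refine ⟨D, ?_, ?_, ?_⟩
  · intro A y q h1 h2
    exact (hD (Sum.inl ⟨(A, y, q), h1, h2⟩)).1
  · intro q
    obtain ⟨y⟩ := ‹Nonempty X›
    refine (hD (Sum.inl ⟨(∅, y, q), by simp, by simp⟩)).2.mono ?_
    rintro x ⟨hx, hxD⟩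
    exact ⟨hx.2.2, hxD⟩
  · intro p q hpq
    obtain ⟨x, hx, hxD⟩ := (hD (Sum.inr ⟨(p, q), hpq⟩)).1.nonempty
    exact ⟨x, hxD, hx⟩

/-- Transfer of a good height function to an open set of reals. -/
theorem push_g {X : Type*} [Countable X] [Nonempty X] {r : X → X → Prop} {h : X → ℚ}
    (hg : GoodH r h) : ∃ D : Set X, ∀ O : Set ℝ, IsOpen O → O.Nonempty → ∃ g : X → ℝ,
    (∀ x, g x ∈ O) ∧ (∀ x y, r x y → g x < g y) ∧
    (∀ (A : Finset X) (y : X) (e : ℝ), y ∉ A → (∀ a ∈ A, g a < e) → (∃ e' ∈ O, e' < e) →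
      ({y' | y' ∉ A ∧ SameType r A y y' ∧ g y' < e} ∩ D).Infinite) ∧
    (∀ e : ℝ, (∃ e' ∈ O, e' < e) → ({x | g x < e} \ D).Infinite) ∧
    (∀ p q : ℝ, p < q → Ioo p q ⊆ O → ∃ x ∈ D, p < g x ∧ g x < q) := by
  classical
  obtain ⟨D, hD1, hD2, hD3⟩ := hg.split
  refine ⟨D, fun O hO hne => ?_⟩
  have hup : ∀ x ∈ O, ∀ e, x < e → ∃ q : ℚ, (q : ℝ) ∈ O ∧ x < q ∧ q < e := by
    intro x hx e hxe
    obtain ⟨u, hu, hsub⟩ := exists_Ico_subset_of_mem_nhds (hO.mem_nhds hx) ⟨e, hxe⟩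
    obtain ⟨q, hq1, hq2⟩ := exists_rat_btwn (lt_min hu hxe)
    exact ⟨q, hsub ⟨hq1.le, hq2.trans_le (min_le_left _ _)⟩, hq1, hq2.trans_le (min_le_right _ _)⟩
  have hdown : ∀ x ∈ O, ∃ q : ℚ, (q : ℝ) ∈ O ∧ q < x := by
    intro x hx
    obtain ⟨u, hu, hsub⟩ := exists_Ioc_subset_of_mem_nhds (hO.mem_nhds hx) ⟨x - 1, by linarith⟩
    obtain ⟨q, hq1, hq2⟩ := exists_rat_btwn hu
    exact ⟨q, hsub ⟨hq1, hq2.le⟩, hq2⟩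
  let Q := {q : ℚ // (q : ℝ) ∈ O}
  have : Nonempty Q := by
    obtain ⟨x, hx⟩ := hne
    obtain ⟨q, hq, _⟩ := hdown x hx
    exact ⟨⟨q, hq⟩⟩
  have : NoMinOrder Q := ⟨fun a => by
    obtain ⟨q, hq, h1⟩ := hdown _ a.2
    exact ⟨⟨q, hq⟩, by exact_mod_cast h1⟩⟩
  have : NoMaxOrder Q := ⟨fun a => by
    obtain ⟨q, hq, h1, _⟩ := hup _ a.2 (a.1 + 1) (by linarith)
    exact ⟨⟨q, hq⟩, by exact_mod_cast h1⟩⟩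
  have : DenselyOrdered Q := ⟨fun a b hab => by
    have hab' : (a.1 : ℝ) < b.1 := by exact_mod_cast hab
    obtain ⟨q, hq, h1, h2⟩ := hup _ a.2 b.1 hab'
    exact ⟨⟨q, hq⟩, by exact_mod_cast h1, by exact_mod_cast h2⟩⟩
  obtain ⟨φ⟩ := Order.iso_of_countable_dense ℚ Q
  let g : X → ℝ := fun x => ((φ (h x)).1 : ℝ)
  have hglt : ∀ x (q : Q), g x < q.1 ↔ h x < φ.symm q := by
    intro x q
    rw [← φ.lt_iff_lt, φ.apply_symm_apply]
    exact Rat.cast_lt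
  have hltg : ∀ x (q : Q), (q.1 : ℝ) < g x ↔ φ.symm q < h x := by
    intro x q
    rw [← φ.lt_iff_lt, φ.apply_symm_apply]
    exact Rat.cast_lt
  have hb : ∀ (A : Finset X) (e : ℝ), (∀ a ∈ A, g a < e) → (∃ e' ∈ O, e' < e) →
      ∃ q : Q, (q.1 : ℝ) < e ∧ ∀ a ∈ A, g a < q.1 := by
    rintro A e hA ⟨e', he', hlt⟩
    obtain ⟨M, hM, hM2⟩ : ∃ M ∈ O, M < e ∧ ∀ a ∈ A, g a ≤ M := by
      clear hD1 hD2 hD3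
      induction A using Finset.induction_on with
      | empty => exact ⟨e', he', hlt, by simp⟩
      | insert a s _ ih =>
        obtain ⟨M, h1, h2, h3⟩ := ih (fun a ha => hA a (Finset.mem_insert_of_mem ha))
        rcases le_total (g a) M with h | h
        · exact ⟨M, h1, h2, by
            intro b hb
            rcases Finset.mem_insert.1 hb with rfl | hb
            · exact h
            · exact h3 b hb⟩
        · exact ⟨g a, (φ (_)).2, hA a (Finset.mem_insert_self _ _), by
            intro b hb
            rcases Finset.mem_insert.1 hb with rfl | hb
            · exact le_rfl
            · exact (h3 b hb).trans h⟩
    obtain ⟨q, hq, h1, h2⟩ := hup M hM e hM2.1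
    exact ⟨⟨q, hq⟩, h2, fun a ha => (hM2.2 a ha).trans_lt h1⟩
  refine ⟨g, fun x => (φ (h x)).2, ?_, ?_, ?_, ?_⟩
  · intro x y hxy
    have := φ.lt_iff_lt.2 (hg.mono x y hxy)
    exact Rat.cast_lt.2 this
  · intro A y e hy hA he
    obtain ⟨q, hq1, hq2⟩ := hb A e hA he
    refine (hD1 A y (φ.symm q) hy (fun a ha => (hglt a q).1 (hq2 a ha))).mono ?_
    rintro z ⟨⟨h1, h2, h3⟩, h4⟩
    exact ⟨⟨h1, h2, ((hglt z q).2 h3).trans hq1⟩, h4⟩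
  · intro e he
    obtain ⟨q, hq1, hq2⟩ := hb ∅ e (by simp) he
    refine (hD2 (φ.symm q)).mono ?_
    rintro z ⟨h1, h2⟩
    exact ⟨((hglt z q).2 h1).trans hq1, h2⟩
  · intro p q hpq hsub
    obtain ⟨a, ha1, ha2⟩ := exists_rat_btwn hpq
    obtain ⟨b, hb1, hb2⟩ := exists_rat_btwn ha2
    have haO : (a : ℝ) ∈ O := hsub ⟨ha1, ha2⟩
    have hbO : (b : ℝ) ∈ O := hsub ⟨ha1.trans hb1, hb2⟩
    have hab : (⟨a, haO⟩ : Q) < ⟨b, hbO⟩ := by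
      have : a < b := by exact_mod_cast hb1
      exact this
    obtain ⟨x, hxD, h1, h2⟩ := hD3 _ _ (φ.symm.lt_iff_lt.2 hab)
    exact ⟨x, hxD, ha1.trans ((hltg x _).2 h1), ((hglt x _).2 h2).trans hb2⟩


theorem exists_jump {K : Set ℝ} (hK : IsCompact K) {s c t : ℝ} (hs : s ∈ K) (ht : t ∈ K)
    (hsc : s < c) (hct : c < t) (hc : c ∉ K) :
    ∃ a b, JumpAt K a b ∧ s ≤ a ∧ b ≤ t := by
  have h1 : IsCompact (K ∩ Icc s c) := hK.inter_right isClosed_Icc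
  have h2 : IsCompact (K ∩ Icc c t) := hK.inter_right isClosed_Icc
  obtain ⟨a, ha, ha'⟩ := h1.exists_isGreatest ⟨s, hs, le_rfl, hsc.le⟩
  obtain ⟨b, hb, hb'⟩ := h2.exists_isLeast ⟨t, ht, hct.le, le_rfl⟩
  have hac : a < c := lt_of_le_of_ne ha.2.2 (fun e => hc (e ▸ ha.1))
  have hcb : c < b := lt_of_le_of_ne hb.2.1 (fun e => hc (e ▸ hb.1))
  refine ⟨a, b, ⟨ha.1, hb.1, hac.trans hcb, ?_⟩, ha.2.1, hb.2.2⟩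
  intro d hd had hdb
  rcases le_total d c with h | h
  · exact absurd (ha' ⟨hd, ha.2.1.trans had.le, h⟩) (not_le.2 had)
  · exact absurd (hb' ⟨hd, h, hdb.le.trans hb.2.2⟩) (not_le.2 hdb)

theorem not_jump_interior {K : Set ℝ} {a b : ℝ} (ha : a ∈ interior K) : ¬ JumpAt K a b := by
  rintro ⟨_, _, hab, h⟩
  obtain ⟨u, hu, hsub⟩ := exists_Ico_subset_of_mem_nhds (isOpen_interior.mem_nhds ha) ⟨b, hab⟩
  obtain ⟨c, hc1, hc2⟩ := exists_between (lt_min hu hab)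
  exact h c (interior_subset (hsub ⟨hc1.le, hc2.trans_le (min_le_left _ _)⟩)) hc1
    (hc2.trans_le (min_le_right _ _))

theorem jumps_countable (K : Set ℝ) : {a | ∃ b, JumpAt K a b}.Countable := by
  have : ∀ a : {a | ∃ b, JumpAt K a b}, ∃ q : ℚ, (a : ℝ) < q ∧ ∀ c ∈ K, (a : ℝ) < c → (q : ℝ) < c := by
    rintro ⟨a, b, h⟩
    obtain ⟨q, h1, h2⟩ := exists_rat_btwn h.2.2.1
    exact ⟨q, h1, fun c hc hac => h2.trans_le (not_lt.1 (h.2.2.2 c hc hac))⟩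
  choose f hf using this
  have hinj : Function.Injective f := by
    intro a a' e
    apply Subtype.ext
    rcases lt_trichotomy a.1 a'.1 with h | h | h
    · obtain ⟨b, hb⟩ := a'.2
      have h1 := (hf a).2 _ hb.1 h
      have h2 := (hf a').1
      rw [e] at h1; exact absurd h1 (not_lt.2 h2.le)
    · exact h
    · obtain ⟨b, hb⟩ := a.2
      have h1 := (hf a').2 _ hb.1 h
      have h2 := (hf a).1
      rw [e] at h2; exact absurd h1 (not_lt.2 h2.le)
  exact Set.countable_coe_iff.1 hinj.countable

/-- What we want from an assignment of thresholds. -/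
structure Assigned {X : Type*} (r : X → X → Prop) (K : Set ℝ) (m : ℝ) (β : X → ℝ) : Prop where
  mem : ∀ x, β x ∈ K
  one : ∀ a b, JumpAt K a b → ∃! x, β x = a
  anti : ∀ x y, (¬ ∃ b, JumpAt K (β x) b) → β y ≤ β x → ¬ r x y
  dense : ∀ s ∈ K, ∀ t ∈ K, s < t → ∃ x, s ≤ β x ∧ β x < t
  ext : ∀ t ∈ K, m < t → ExtSet r {x | β x < t}

theorem assign_core {X : Type*} {r : X → X → Prop} {K : Set ℝ} (hK : IsCompact K) {m : ℝ}
    (hm : IsLeast K m) {O : Set ℝ} (hO1 : ∀ e ∈ O, m ≤ e → e ∈ interior K)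
    (hO2 : interior K ⊆ O) (hO3 : ∀ t ∈ K, m < t → ∃ e ∈ O, e < t)
    {D : Set X} {g : X → ℝ} (hgO : ∀ x, g x ∈ O) (hgr : ∀ x y, r x y → g x < g y)
    (hb : ∀ (A : Finset X) (y : X) (e : ℝ), y ∉ A → (∀ a ∈ A, g a < e) → (∃ e' ∈ O, e' < e) →
      ({y' | y' ∉ A ∧ SameType r A y y' ∧ g y' < e} ∩ D).Infinite)
    (hd : ∀ p q : ℝ, p < q → Ioo p q ⊆ O → ∃ x ∈ D, p < g x ∧ g x < q)
    {Y : Set X} {β : X → ℝ} (hoff : ∀ x, x ∉ Y → β x = g x)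
    (hle : ∀ x, g x ≤ β x) (hYJ : ∀ x ∈ Y, ∃ b, JumpAt K (β x) b)
    (hinj : InjOn β Y) (hsurj : ∀ a b, JumpAt K a b → ∃ x ∈ Y, β x = a)
    (hmY : ∀ x, g x < m → x ∈ Y) (hDY : ∀ x ∈ D, x ∈ Y → g x < m)
    (hfin : ∀ t ∈ K, m < t → {x | x ∈ D ∧ g x < t ∧ t ≤ β x}.Finite) :
    Assigned r K m β := by
  classical
  have hintK : ∀ x, x ∉ Y → β x ∈ interior K := by
    intro x hx
    rw [hoff x hx]
    refine hO1 _ (hgO x) ?_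
    by_contra h
    exact hx (hmY x (not_le.1 h))
  refine ⟨?_, ?_, ?_, ?_, ?_⟩
  · intro x
    by_cases hx : x ∈ Y
    · obtain ⟨b, h⟩ := hYJ x hx; exact h.1
    · exact interior_subset (hintK x hx)
  · intro a b hab
    obtain ⟨x, hx, hxa⟩ := hsurj a b hab
    refine ⟨x, hxa, fun y hy => ?_⟩
    have hyY : y ∈ Y := by
      by_contra h
      have h2 := hintK y h
      rw [hy] at h2
      exact not_jump_interior h2 hab
    exact hinj hyY hx (hy.trans hxa.symm)
  · intro x y hx hyx hr
    have hxY : x ∉ Y := fun h => hx (hYJ x h)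
    rw [hoff x hxY] at hyx
    exact absurd (hgr x y hr) (not_lt.2 ((hle y).trans hyx))
  · intro s hs t ht hst
    by_cases hsub : Ioo s t ⊆ K
    · have h1 : Ioo s t ⊆ interior K := interior_maximal hsub isOpen_Ioo
      obtain ⟨x, hxD, h2, h3⟩ := hd s t hst (h1.trans hO2)
      have hxY : x ∉ Y := by
        intro h
        exact absurd (hDY x hxD h) (not_lt.2 ((hm.2 hs).trans h2.le))
      exact ⟨x, by rw [hoff x hxY]; exact h2.le, by rw [hoff x hxY]; exact h3⟩
    · obtain ⟨c, hc, hcK⟩ := not_subset.1 hsub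
      obtain ⟨a, b, hab, h1, h2⟩ := exists_jump hK hs ht hc.1 hc.2 hcK
      obtain ⟨x, _, rfl⟩ := hsurj a b hab
      exact ⟨x, h1, hab.2.2.1.trans_le h2⟩
  · intro t ht hmt A hA hAt y hy
    have h1 := hb hA.toFinset y t (by simpa using hy) (by
      intro a ha
      exact (hle a).trans_lt (hAt (hA.mem_toFinset.1 ha))) (hO3 t ht hmt)
    obtain ⟨z, ⟨⟨hz1, hz2, hz3⟩, hz4⟩, hz5⟩ := h1.exists_notMem_finite (hfin t ht hmt)
    refine ⟨z, ?_, by simpa using hz1, by simpa using hz2⟩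
    by_contra h
    exact hz5 ⟨hz4, hz3, not_lt.1 h⟩

theorem assign {X : Type*} [Countable X] [Nonempty X] {r : X → X → Prop} {h : X → ℚ}
    (hg : GoodH r h) {K : Set ℝ} (hK : IsCompact K) {m : ℝ}
    (hm : IsLeast K m) (hacc : AccPt m (Filter.principal K)) :
    ∃ β : X → ℝ, Assigned r K m β := by
  classical
  obtain ⟨D, hD⟩ := push_g hg
  have hacc' : ∀ t, m < t → ∃ s ∈ K, m < s ∧ s < t := by
    intro t hmt
    rw [accPt_iff_nhds] at hacc
    obtain ⟨y, ⟨hy1, hy2⟩, hy3⟩ := hacc (Iio t) (Iio_mem_nhds hmt)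
    exact ⟨y, hy2, lt_of_le_of_ne (hm.2 hy2) hy3.symm, hy1⟩
  have hmJ : ∀ b, ¬ JumpAt K m b := by
    intro b hb
    obtain ⟨s, hs, h1, h2⟩ := hacc' b hb.2.2.1
    exact hb.2.2.2 s hs h1 h2
  have hJgt : ∀ a b, JumpAt K a b → m < a := by
    intro a b hab
    refine lt_of_le_of_ne (hm.2 hab.1) ?_
    rintro rfl; exact hmJ b hab
  have hmi : ∀ e ∈ interior K, m < e := by
    intro e he
    refine lt_of_le_of_ne (hm.2 (interior_subset he)) ?_
    rintro rfl
    obtain ⟨u, hu, hsub⟩ := exists_Ioc_subset_of_mem_nhds (isOpen_interior.mem_nhds he)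
      ⟨m - 1, by linarith⟩
    obtain ⟨c, hc1, hc2⟩ := exists_between hu
    exact absurd (hm.2 (interior_subset (hsub ⟨hc1, hc2.le⟩))) (not_le.2 hc2)
  let J : Set ℝ := {a | ∃ b, JumpAt K a b}
  have hJc : J.Countable := jumps_countable K
  have : Countable J := hJc.to_subtype
  by_cases hcase : m ∈ closure (interior K)
  · have hO3 : ∀ t, m < t → ∃ e ∈ interior K, e < t := by
      intro t hmt
      obtain ⟨e, he1, he2⟩ := mem_closure_iff.1 hcase (Iio t) isOpen_Iio hmt
      exact ⟨e, he2, he1⟩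
    obtain ⟨e0, he0, _⟩ := hO3 (m + 1) (by linarith)
    obtain ⟨g, hgO, hgr, hb, hc, hd⟩ := hD (interior K) isOpen_interior ⟨e0, he0⟩
    obtain ⟨c, hcinj, hc2⟩ := inj_choice (fun j : J => {x | g x < j} \ D) (by
      rintro ⟨a, b, hab⟩
      exact hc a (hO3 a (hJgt a b hab)))
    let β : X → ℝ := fun x => if hx : ∃ j, c j = x then (hx.choose : ℝ) else g x
    have hβc : ∀ j, β (c j) = j := by
      intro j
      have hx : ∃ j', c j' = c j := ⟨j, rfl⟩
      have : β (c j) = (hx.choose : ℝ) := dif_pos hx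
      rw [this, hcinj hx.choose_spec]
    refine ⟨β, assign_core hK hm (fun e he _ => he) subset_rfl (fun t _ ht => hO3 t ht) hgO hgr hb hd
      (Y := range c) ?_ ?_ ?_ ?_ ?_ ?_ ?_ ?_⟩
    · intro x hx
      exact dif_neg hx
    · intro x
      by_cases hx : x ∈ range c
      · obtain ⟨j, rfl⟩ := hx
        rw [hβc]; exact (hc2 j).1.le
      · exact le_of_eq (show β x = g x from dif_neg hx).symm
    · rintro _ ⟨j, rfl⟩
      rw [hβc]; exact j.2
    · rintro _ ⟨j, rfl⟩ _ ⟨k, rfl⟩ e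
      rw [hβc, hβc] at e
      rw [Subtype.ext e]
    · intro a b hab
      exact ⟨c ⟨a, b, hab⟩, ⟨_, rfl⟩, hβc _⟩
    · intro x hx
      exact absurd (hmi _ (hgO x)) (not_lt.2 hx.le)
    · rintro _ hxD ⟨j, rfl⟩
      exact absurd hxD (hc2 j).2
    · intro t _ _
      convert Set.finite_empty
      ext x
      simp only [mem_ofPred_eq, mem_empty_iff_false, iff_false, not_and, not_le]
      intro hxD hxt
      have hx : x ∉ range c := by
        rintro ⟨j, rfl⟩; exact (hc2 j).2 hxD
      rw [show β x = g x from dif_neg hx]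
      exact hxt
  · let O : Set ℝ := interior K ∪ Ioo (m - 1) m
    have hOopen : IsOpen O := isOpen_interior.union isOpen_Ioo
    have hO3 : ∃ e' ∈ O, e' < m := ⟨m - 1/2, Or.inr ⟨by linarith, by linarith⟩, by linarith⟩
    obtain ⟨g, hgO, hgr, hb, hc, hd⟩ := hD O hOopen ⟨_, hO3.choose_spec.1⟩
    have hJacc : ∀ t, m < t → ∃ j ∈ J, j < t := by
      intro t hmt
      have hV : (closure (interior K))ᶜ ∈ nhds m := isClosed_closure.isOpen_compl.mem_nhds hcase
      obtain ⟨u, hu, hsub⟩ := exists_Ico_subset_of_mem_nhds hV ⟨t, hmt⟩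
      obtain ⟨s2, hs2, h1, h2⟩ := hacc' (min u t) (lt_min hu hmt)
      obtain ⟨s1, hs1, h3, h4⟩ := hacc' s2 h1
      have hns : ¬ Ioo s1 s2 ⊆ K := by
        intro hs
        obtain ⟨c, hc1, hc2⟩ := exists_between h4
        have hcc : c ∈ interior K := interior_maximal hs isOpen_Ioo ⟨hc1, hc2⟩
        exact hsub ⟨(h3.trans hc1).le, hc2.trans (h2.trans_le (min_le_left _ _))⟩
          (subset_closure hcc)
      obtain ⟨c, hc, hcK⟩ := not_subset.1 hns
      obtain ⟨a, b, hab, h5, h6⟩ := exists_jump hK hs1 hs2 hc.1 hc.2 hcK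
      exact ⟨a, ⟨b, hab⟩, hab.2.2.1.trans_le (h6.trans (h2.le.trans (min_le_right _ _)))⟩
    have hJglb : IsGLB J m := by
      refine ⟨?_, ?_⟩
      · rintro a ⟨b, hab⟩; exact (hJgt a b hab).le
      · intro t ht
        by_contra h
        obtain ⟨j, hj, hjt⟩ := hJacc t (not_le.1 h)
        exact absurd (ht hj) (not_le.2 hjt)
    obtain ⟨u, hu1, hu2, hu3, hu4⟩ := hJglb.exists_seq_strictAnti_tendsto_of_notMem
      (fun ⟨b, hb⟩ => hmJ b hb) (by
        obtain ⟨j, hj, _⟩ := hJacc (m+1) (by linarith); exact ⟨j, hj⟩)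
    let Y1 : Set X := {x | g x < m} ∩ D
    let Y2 : Set X := {x | g x < m} \ D
    have hY1 : Y1.Infinite := by
      obtain ⟨y⟩ := ‹Nonempty X›
      refine (hb ∅ y m (by simp) (by simp) hO3).mono ?_
      rintro x ⟨hx, hxD⟩
      exact ⟨hx.2.2, hxD⟩
    have hY2 : Y2.Infinite := hc m hO3
    let U : Set ℝ := range (fun n => u (2 * n))
    have hJU : (J \ U).Infinite := by
      have : (range (fun n => u (2 * n + 1))).Infinite := by
        apply Set.infinite_range_of_injective
        intro a b e
        have := hu1.injective e
        omega
      refine this.mono ?_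
      rintro _ ⟨n, rfl⟩
      refine ⟨hu4 _, ?_⟩
      rintro ⟨k, hk⟩
      have := hu1.injective hk
      omega
    have := hY1.to_subtype
    have := hY2.to_subtype
    have := hJU.to_subtype
    have : Countable ↥(J \ U) := (hJc.mono sdiff_subset).to_subtype
    obtain ⟨e1⟩ : Nonempty (Y1 ≃ ℕ) := nonempty_equiv_of_countable
    obtain ⟨e2⟩ : Nonempty (Y2 ≃ ↥(J \ U)) := nonempty_equiv_of_countable
    let β : X → ℝ := fun x => if hx : x ∈ Y1 then u (2 * e1 ⟨x, hx⟩) else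
      if hx2 : x ∈ Y2 then (e2 ⟨x, hx2⟩ : ℝ) else g x
    have hβ1 : ∀ x (hx : x ∈ Y1), β x = u (2 * e1 ⟨x, hx⟩) := fun x hx => dif_pos hx
    have hβ2 : ∀ x (hx : x ∈ Y2), β x = (e2 ⟨x, hx⟩ : ℝ) := fun x hx => by
      have : x ∉ Y1 := fun h => hx.2 h.2
      simp only [β, dif_neg this, dif_pos hx]
    have hβ3 : ∀ x, ¬ g x < m → β x = g x := by
      intro x hx
      have h1 : x ∉ Y1 := fun h => hx h.1
      have h2 : x ∉ Y2 := fun h => hx h.1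
      simp only [β, dif_neg h1, dif_neg h2]
    have hY12 : ∀ x, g x < m → x ∈ Y1 ∨ x ∈ Y2 := by
      intro x hx
      by_cases hxD : x ∈ D
      · exact Or.inl ⟨hx, hxD⟩
      · exact Or.inr ⟨hx, hxD⟩
    have hβJ : ∀ x, g x < m → β x ∈ J := by
      intro x hx
      rcases hY12 x hx with h | h
      · rw [hβ1 x h]; exact hu4 _
      · rw [hβ2 x h]; exact (e2 ⟨x, h⟩).2.1
    refine ⟨β, assign_core hK hm (O := O) ?_ subset_union_left ?_ hgO hgr hb hd
      (Y := {x | g x < m}) (fun x hx => hβ3 x hx) ?_ (fun x hx => hβJ x hx) ?_ ?_ (fun x hx => hx)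
      (fun x _ hx => hx) ?_⟩
    · rintro e (he | he) hme
      · exact he
      · exact absurd he.2 (not_lt.2 hme)
    · intro t _ hmt
      obtain ⟨e, he, h⟩ := hO3
      exact ⟨e, he, h.trans hmt⟩
    · intro x
      by_cases hx : g x < m
      · obtain ⟨b, hb⟩ := hβJ x hx
        exact (hx.trans (hJgt _ _ hb)).le
      · exact (hβ3 x hx).ge
    · intro x hx y hy e
      rcases hY12 x hx with h | h <;> rcases hY12 y hy with h' | h'
      · rw [hβ1 x h, hβ1 y h'] at e
        have := hu1.injective e
        have h3 : e1 ⟨x, h⟩ = e1 ⟨y, h'⟩ := by omega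
        exact congrArg Subtype.val (e1.injective h3)
      · rw [hβ1 x h, hβ2 y h'] at e
        exact absurd ⟨_, e⟩ (e2 ⟨y, h'⟩).2.2
      · rw [hβ2 x h, hβ1 y h'] at e
        exact absurd ⟨_, e.symm⟩ (e2 ⟨x, h⟩).2.2
      · rw [hβ2 x h, hβ2 y h'] at e
        exact congrArg Subtype.val (e2.injective (Subtype.ext e))
    · intro a b hab
      by_cases haU : a ∈ U
      · obtain ⟨n, rfl⟩ := haU
        refine ⟨e1.symm n, (e1.symm n).2.1, ?_⟩
        rw [hβ1 _ (e1.symm n).2]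
        simp
      · refine ⟨e2.symm ⟨a, ⟨b, hab⟩, haU⟩, (e2.symm _).2.1, ?_⟩
        rw [hβ2 _ (e2.symm _).2]
        simp
    · intro t _ hmt
      have hev : ∀ᶠ n in Filter.atTop, u n < t := hu3.eventually_lt_const hmt
      obtain ⟨N, hN⟩ := Filter.eventually_atTop.1 hev
      refine (Set.Finite.image (fun n => ((e1.symm n : Y1) : X)) (Set.finite_Iio N)).subset ?_
      rintro x ⟨hxD, hxt, htx⟩
      have hxm : g x < m := by
        by_contra h
        rw [hβ3 x h] at htx
        exact absurd hxt (not_lt.2 htx)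
      have hx1 : x ∈ Y1 := ⟨hxm, hxD⟩
      refine ⟨e1 ⟨x, hx1⟩, ?_, by simp⟩
      rw [hβ1 x hx1] at htx
      by_contra h
      have h2 : N ≤ e1 ⟨x, hx1⟩ := not_lt.1 h
      exact absurd (hN (2 * e1 ⟨x, hx1⟩) (by omega)) (not_lt.2 htx)


theorem back_good {X : Type*} [Countable X] [Nonempty X] {r : X → X → Prop}
    (hirr : ∀ x, ¬ r x x) (hu : UltrahomogeneousRel r) (hmax : ∀ x, ∃ y, r x y) {h : X → ℚ}
    (hg : GoodH r h) {K : Set ℝ} (hK : IsCompact K) {m : ℝ}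
    (hm : IsLeast K m) (hacc : AccPt m (Filter.principal K)) :
    ∃ C : Set (Set X), IsMaxChainIn (Copies r ∪ {∅}) C ∧ Nonempty (↥K ≃o ↥C) := by
  obtain ⟨β, hβ⟩ := assign hg hK hm hacc
  refine chain_lemma hmax hK hm β hβ.mem ?_ hβ.anti hβ.dense
    (fun t ht hmt => copy_of_ext hirr hu (hβ.ext t ht hmt))
  intro a b hab B _ h1 h2
  obtain ⟨x, hx, hx'⟩ := hβ.one a b hab
  have key : ∀ y, β y < b → β y < a ∨ y = x := by
    intro y hy
    rcases lt_trichotomy (β y) a with h | h | h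
    · exact Or.inl h
    · exact Or.inr (hx' y h)
    · exact absurd hy (hab.2.2.2 _ (hβ.mem y) h)
  by_cases hxB : x ∈ B
  · right
    refine Subset.antisymm h2 fun y hy => ?_
    rcases key y hy with h | rfl
    · exact h1 h
    · exact hxB
  · left
    refine Subset.antisymm (fun y hy => ?_) h1
    rcases key y (h2 hy) with h | rfl
    · exact h
    · exact absurd hy hxB

theorem rat_gap (A : Finset ℚ) (y q : ℚ) (hy : y ∉ A) (hA : ∀ a ∈ A, a < q) :
    ∃ p z : ℚ, p < z ∧ z ≤ q ∧ ∀ w, p < w → w < z →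
      (w ∉ A ∧ ∀ a ∈ A, (a < y ↔ a < w) ∧ (y < a ↔ w < a)) := by
  obtain ⟨p, hp1, hp2⟩ : ∃ p, p < min y q ∧ ∀ a ∈ A, a < y → a ≤ p := by
    clear hy
    induction A using Finset.induction_on with
    | empty => exact ⟨min y q - 1, by linarith, by simp⟩
    | insert a s _ ih =>
      obtain ⟨p, h1, h2⟩ := ih (fun a ha => hA a (Finset.mem_insert_of_mem ha))
      by_cases hay : a < y
      · refine ⟨max p a, max_lt h1 (lt_min hay (hA a (Finset.mem_insert_self _ _))), ?_⟩
        intro b hb hby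
        rcases Finset.mem_insert.1 hb with rfl | hb
        · exact le_max_right _ _
        · exact (h2 b hb hby).trans (le_max_left _ _)
      · refine ⟨p, h1, ?_⟩
        intro b hb hby
        rcases Finset.mem_insert.1 hb with rfl | hb
        · exact absurd hby hay
        · exact h2 b hb hby
  refine ⟨p, min y q, hp1, min_le_right _ _, fun w hw1 hw2 => ?_⟩
  have hwy := hw2.trans_le (min_le_left y q)
  have key : ∀ a ∈ A, (a < y ↔ a < w) ∧ (y < a ↔ w < a) := by
    intro a ha
    refine ⟨⟨fun h => (hp2 a ha h).trans_lt hw1, fun h => h.trans hwy⟩,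
      ⟨fun h => hwy.trans h, fun h => ?_⟩⟩
    rcases lt_trichotomy a y with h1 | h1 | h1
    · exact absurd (hp2 a ha h1) (not_le.2 (hw1.trans h))
    · exact absurd (h1 ▸ ha) hy
    · exact h1
  refine ⟨fun hwA => ?_, key⟩
  exact absurd ((key w hwA).1.1 hwy) (lt_irrefl _)

theorem goodH_comp {X ι : Type*} {r : X → X → Prop} (cls : X → ι) (h : X → ℚ)
    (hr : ∀ x y, r x y ↔ cls x = cls y ∧ h x < h y)
    (hinj : ∀ x y, cls x = cls y → h x = h y → x = y)
    (hsurj : ∀ x q, ∃ y, cls y = cls x ∧ h y = q) [Nonempty X] : GoodH r h := by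
  classical
  refine ⟨fun x y hxy => ((hr x y).1 hxy).2, ?_, ?_⟩
  · intro A y q hy hA
    obtain ⟨p, z, hpz, hzq, hw⟩ := rat_gap ((A.filter (fun a => cls a = cls y)).image h) (h y) q (by
      intro hh
      obtain ⟨a, ha, e⟩ := Finset.mem_image.1 hh
      rw [Finset.mem_filter] at ha
      exact hy (hinj _ _ ha.2 e ▸ ha.1)) (by
      intro b hb
      obtain ⟨a, ha, rfl⟩ := Finset.mem_image.1 hb
      exact hA a (Finset.mem_filter.1 ha).1)
    choose f hf1 hf2 using hsurj y
    have hfi : Function.Injective f := fun a b e => by rw [← hf2 a, ← hf2 b, e]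
    refine ((Ioo_infinite hpz).image hfi.injOn).mono ?_
    rintro _ ⟨w, ⟨hw1, hw2⟩, rfl⟩
    obtain ⟨h1, h2⟩ := hw w hw1 hw2
    refine ⟨fun hfA => h1 ?_, ?_, ?_⟩
    · exact Finset.mem_image.2 ⟨f w, Finset.mem_filter.2 ⟨hfA, hf1 w⟩, hf2 w⟩
    · intro a ha
      simp only [hr, hf1, hf2]
      by_cases hc : cls a = cls y
      · have := h2 (h a) (Finset.mem_image.2 ⟨a, Finset.mem_filter.2 ⟨ha, hc⟩, rfl⟩)
        exact ⟨and_congr_right fun _ => this.1, and_congr_right fun _ => this.2⟩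
      · exact ⟨⟨fun h => absurd h.1 hc, fun h => absurd h.1 hc⟩,
          ⟨fun h => absurd h.1.symm hc, fun h => absurd h.1.symm hc⟩⟩
    · rw [hf2]; exact hw2.trans_le hzq
  · intro p q hpq
    obtain ⟨x⟩ := ‹Nonempty X›
    obtain ⟨z, h1, h2⟩ := exists_between hpq
    obtain ⟨y, _, hy⟩ := hsurj x z
    exact ⟨y, hy ▸ h1, hy ▸ h2⟩

theorem goodH_rat : GoodH (fun a b : ℚ => a < b) id :=
  goodH_comp (fun _ => ()) id (by simp) (by simp) (fun x q => ⟨q, rfl, rfl⟩)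

theorem goodH_weak {X : Type*} {r : X → X → Prop} (π : X → ℚ)
    (hr : ∀ x y, r x y ↔ π x < π y) (hsurj : Function.Surjective π)
    (hinf : ∀ q, (π ⁻¹' {q}).Infinite) : GoodH r π := by
  classical
  refine ⟨fun x y hxy => (hr x y).1 hxy, ?_, ?_⟩
  · intro A y q hy hA
    by_cases hyq : π y < q
    · refine ((hinf (π y)).sdiff A.finite_toSet).mono ?_
      rintro z ⟨hz1, hz2⟩
      have hz1' : π z = π y := hz1
      refine ⟨hz2, ?_, hz1' ▸ hyq⟩
      intro a _
      simp [hr, hz1']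
    · obtain ⟨p, z, hpz, hzq, hw⟩ := rat_gap (A.image π) q q (by
        intro hh
        obtain ⟨a, ha, e⟩ := Finset.mem_image.1 hh
        exact absurd (hA a ha) (not_lt.2 e.ge)) (by
        intro b hb
        obtain ⟨a, ha, rfl⟩ := Finset.mem_image.1 hb
        exact hA a ha)
      obtain ⟨w, hw1, hw2⟩ := exists_between hpz
      obtain ⟨h1, h2⟩ := hw w hw1 hw2
      refine (hinf w).mono ?_
      intro z hz
      have hz' : π z = w := hz
      refine ⟨fun hzA => h1 (Finset.mem_image.2 ⟨z, hzA, hz'⟩), ?_, by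
        rw [hz']; exact hw2.trans_le hzq⟩
      intro a ha
      have h3 := h2 (π a) (Finset.mem_image.2 ⟨a, ha, rfl⟩)
      have h4 := hA a ha
      simp only [hr, hz']
      have h5 := h3.1.1 h4
      exact ⟨⟨fun _ => h5, fun _ => h4.trans_le (not_lt.1 hyq)⟩,
        ⟨fun h => absurd (h.trans h4) hyq, fun h => absurd h (not_lt.2 h5.le)⟩⟩
  · intro p q hpq
    obtain ⟨z, h1, h2⟩ := exists_between hpq
    obtain ⟨y, hy⟩ := hsurj z
    exact ⟨y, hy ▸ h1, hy ▸ h2⟩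

theorem back_weak_fin {X : Type*} [Countable X] {r : X → X → Prop}
    (hirr : ∀ x, ¬ r x x) (hu : UltrahomogeneousRel r) (hmax : ∀ x, ∃ y, r x y) (π : X → ℚ)
    (hr : ∀ x y, r x y ↔ π x < π y) (hsurj : Function.Surjective π) (k : ℕ)
    (hfin : ∀ q, (π ⁻¹' {q}).Finite ∧ (π ⁻¹' {q}).ncard = k)
    {K : Set ℝ} (hK : IsCompact K) {m : ℝ}
    (hm : IsLeast K m) (hacc : AccPt m (Filter.principal K)) :
    ∃ C : Set (Set X), IsMaxChainIn (Copies r ∪ {∅}) C ∧ Nonempty (↥K ≃o ↥C) := by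
  obtain ⟨β, hβ⟩ := assign goodH_rat hK hm hacc
  refine chain_lemma hmax hK hm (fun x => β (π x)) (fun x => hβ.mem _) ?_ ?_ ?_ ?_
  · rintro a b hab B ⟨f, hf1, rfl, hf3⟩ h1 h2
    obtain ⟨q, hq, hq'⟩ := hβ.one a b hab
    have key : ∀ y, β (π y) < b → β (π y) < a ∨ π y = q := by
      intro y hy
      rcases lt_trichotomy (β (π y)) a with h | h | h
      · exact Or.inl h
      · exact Or.inr (hq' _ h)
      · exact absurd hy (hab.2.2.2 _ (hβ.mem _) h)
    by_cases hxB : ∃ x ∈ range f, π x = q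
    · right
      obtain ⟨_, ⟨z, rfl⟩, hz⟩ := hxB
      have himg : f '' (π ⁻¹' {π z}) = π ⁻¹' {q} := by
        refine Set.eq_of_subset_of_ncard_le ?_ ?_ (hfin q).1
        · rintro _ ⟨w, hw, rfl⟩
          have hw' : π w = π z := hw
          have e1 := hf3 w z
          have e2 := hf3 z w
          rw [hr, hr] at e1 e2
          change π (f w) = q
          rw [← hz]
          apply le_antisymm
          · exact not_lt.1 (fun h => absurd (e2.2 h) (not_lt.2 hw'.le))
          · exact not_lt.1 (fun h => absurd (e1.2 h) (not_lt.2 hw'.ge))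
        · rw [Set.ncard_image_of_injective _ hf1, (hfin q).2, (hfin (π z)).2]
      refine Subset.antisymm h2 fun y hy => ?_
      rcases key y hy with h | h
      · exact h1 h
      · have : y ∈ f '' (π ⁻¹' {π z}) := by rw [himg]; exact h
        exact image_subset_range _ _ this
    · left
      refine Subset.antisymm (fun y hy => ?_) h1
      rcases key y (h2 hy) with h | h
      · exact h
      · exact absurd ⟨y, hy, h⟩ hxB
  · intro x y hx hy hxy
    exact hβ.anti (π x) (π y) hx hy ((hr x y).1 hxy)
  · intro s hs t ht hst
    obtain ⟨w, hw⟩ := hβ.dense s hs t ht hst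
    obtain ⟨x, rfl⟩ := hsurj w
    exact ⟨x, hw⟩
  · intro t ht hmt
    refine copy_of_ext hirr hu ?_
    intro A hA hAt y hy
    by_cases hyA : π y ∈ π '' A
    · obtain ⟨a, ha, e⟩ := hyA
      refine ⟨y, ?_, hy, fun a _ => ⟨Iff.rfl, Iff.rfl⟩⟩
      change β (π y) < t
      rw [← e]; exact hAt ha
    · obtain ⟨w, hw1, hw2, hw3⟩ := hβ.ext t ht hmt (π '' A) (hA.image _) (by
        rintro _ ⟨a, ha, rfl⟩; exact hAt ha) (π y) hyA
      obtain ⟨z, rfl⟩ := hsurj w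
      refine ⟨z, hw1, fun hz => hw2 ⟨z, hz, rfl⟩, fun a ha => ?_⟩
      rw [hr, hr, hr, hr]
      exact hw3 (π a) ⟨a, ha, rfl⟩


/-- A homogeneous strict partial order which is not an antichain. -/
structure HPO {X : Type*} (r : X → X → Prop) : Prop where
  irr : ∀ x, ¬ r x x
  trans : ∀ x y z, r x y → r y z → r x z
  hu : UltrahomogeneousRel r
  ex : ∃ x y, r x y

theorem HPO.dual {X : Type*} {r : X → X → Prop} (H : HPO r) : HPO (fun x y => r y x) := by
  refine ⟨H.irr, fun x y z h1 h2 => H.trans _ _ _ h2 h1, ?_, ?_⟩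
  · intro A f hA hf h
    obtain ⟨g, h1, h2⟩ := H.hu A f hA hf (fun x hx y hy => h y hy x hx)
    exact ⟨g, fun x y => h1 y x, h2⟩
  · obtain ⟨x, y, h⟩ := H.ex
    exact ⟨y, x, h⟩

theorem HPO.asymm {X : Type*} {r : X → X → Prop} (H : HPO r) {x y : X} (h : r x y) : ¬ r y x :=
  fun h' => H.irr x (H.trans _ _ _ h h')

theorem HPO.ne {X : Type*} {r : X → X → Prop} (H : HPO r) {x y : X} (h : r x y) : x ≠ y := by
  rintro rfl; exact H.irr _ h

theorem HPO.autA2 {X : Type*} {r : X → X → Prop} (H : HPO r) {A : Set X} (hA : A.Finite)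
    {y1 y2 z1 z2 : X} (hy1 : y1 ∉ A) (hy2 : y2 ∉ A) (hz1 : z1 ∉ A) (hz2 : z2 ∉ A)
    (he : y1 = y2 ↔ z1 = z2) (h12 : r y1 y2 ↔ r z1 z2) (h21 : r y2 y1 ↔ r z2 z1)
    (hs1 : SameType r A y1 z1) (hs2 : SameType r A y2 z2) :
    ∃ g : X ≃ X, (∀ x y, r x y ↔ r (g x) (g y)) ∧ (∀ a ∈ A, g a = a) ∧ g y1 = z1 ∧ g y2 = z2 := by
  have hF : (insert (y1, z1) (insert (y2, z2) ((fun a => (a, a)) '' A))).Finite :=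
    ((hA.image _).insert _).insert _
  obtain ⟨g, hg1, hg2⟩ := exists_aut H.hu hF (by
    intro p hp q hq
    simp only [Set.mem_insert_iff, Set.mem_image] at hp hq
    rcases hp with rfl | rfl | ⟨a, ha, rfl⟩ <;> rcases hq with rfl | rfl | ⟨b, hb, rfl⟩
    · simp [H.irr]
    · exact ⟨he, h12⟩
    · exact ⟨⟨fun e => absurd ((show y1 = b from e) ▸ hb) hy1, fun e => absurd ((show z1 = b from e) ▸ hb) hz1⟩, (hs1 b hb).2⟩
    · exact ⟨eq_comm.trans (he.trans eq_comm), h21⟩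
    · simp [H.irr]
    · exact ⟨⟨fun e => absurd ((show y2 = b from e) ▸ hb) hy2, fun e => absurd ((show z2 = b from e) ▸ hb) hz2⟩, (hs2 b hb).2⟩
    · exact ⟨⟨fun e => absurd ((show a = y1 from e) ▸ ha) hy1, fun e => absurd ((show a = z1 from e) ▸ ha) hz1⟩, (hs1 a ha).1⟩
    · exact ⟨⟨fun e => absurd ((show a = y2 from e) ▸ ha) hy2, fun e => absurd ((show a = z2 from e) ▸ ha) hz2⟩, (hs2 a ha).1⟩
    · exact ⟨Iff.rfl, Iff.rfl⟩)
  refine ⟨g, hg1, ?_, ?_, ?_⟩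
  · intro a ha
    exact hg2 (a, a) (Or.inr (Or.inr ⟨a, ha, rfl⟩))
  · exact hg2 _ (Or.inl rfl)
  · exact hg2 _ (Or.inr (Or.inl rfl))

theorem HPO.autA1 {X : Type*} {r : X → X → Prop} (H : HPO r) {A : Set X} (hA : A.Finite)
    {y z : X} (hy : y ∉ A) (hz : z ∉ A) (hs : SameType r A y z) :
    ∃ g : X ≃ X, (∀ x y, r x y ↔ r (g x) (g y)) ∧ (∀ a ∈ A, g a = a) ∧ g y = z := by
  obtain ⟨g, h1, h2, h3, _⟩ := H.autA2 hA hy hy hz hz (by simp) (by simp [H.irr]) (by simp [H.irr]) hs hs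
  exact ⟨g, h1, h2, h3⟩

theorem HPO.aut1 {X : Type*} {r : X → X → Prop} (H : HPO r) (y z : X) :
    ∃ g : X ≃ X, (∀ x y, r x y ↔ r (g x) (g y)) ∧ g y = z := by
  obtain ⟨g, h1, _, h3⟩ := H.autA1 (A := ∅) (by simp) (y := y) (z := z) (by simp) (by simp)
    (fun a ha => absurd ha (by simp))
  exact ⟨g, h1, h3⟩

theorem HPO.aut2 {X : Type*} {r : X → X → Prop} (H : HPO r) {y1 y2 z1 z2 : X}
    (he : y1 = y2 ↔ z1 = z2) (h12 : r y1 y2 ↔ r z1 z2) (h21 : r y2 y1 ↔ r z2 z1) :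
    ∃ g : X ≃ X, (∀ x y, r x y ↔ r (g x) (g y)) ∧ g y1 = z1 ∧ g y2 = z2 := by
  obtain ⟨g, h1, _, h3⟩ := H.autA2 (A := ∅) (by simp) (by simp) (by simp) (by simp) (by simp)
    he h12 h21 (fun a ha => absurd ha (by simp)) (fun a ha => absurd ha (by simp))
  exact ⟨g, h1, h3⟩

theorem HPO.aut_lt {X : Type*} {r : X → X → Prop} (H : HPO r) {y1 y2 z1 z2 : X}
    (h1 : r y1 y2) (h2 : r z1 z2) :
    ∃ g : X ≃ X, (∀ x y, r x y ↔ r (g x) (g y)) ∧ g y1 = z1 ∧ g y2 = z2 :=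
  H.aut2 ⟨fun e => absurd e (H.ne h1), fun e => absurd e (H.ne h2)⟩
    ⟨fun _ => h2, fun _ => h1⟩ ⟨fun e => absurd e (H.asymm h1), fun e => absurd e (H.asymm h2)⟩

theorem HPO.up {X : Type*} {r : X → X → Prop} (H : HPO r) (x : X) : ∃ y, r x y := by
  obtain ⟨a, b, hab⟩ := H.ex
  obtain ⟨g, hg, e⟩ := H.aut1 a x
  exact ⟨g b, e ▸ (hg a b).1 hab⟩

theorem HPO.down {X : Type*} {r : X → X → Prop} (H : HPO r) (x : X) : ∃ y, r y x :=
  H.dual.up x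

theorem HPO.dense {X : Type*} {r : X → X → Prop} (H : HPO r) {x z : X} (h : r x z) :
    ∃ y, r x y ∧ r y z := by
  obtain ⟨y, hy⟩ := H.up x
  obtain ⟨w, hw⟩ := H.up y
  obtain ⟨g, hg, e1, e2⟩ := H.aut_lt (H.trans _ _ _ hy hw) h
  exact ⟨g y, e1 ▸ (hg x y).1 hy, e2 ▸ (hg y w).1 hw⟩

theorem rat_iso {Q : Type*} [Countable Q] [Nonempty Q] (s : Q → Q → Prop) (irr : ∀ x, ¬ s x x)
    (trans : ∀ x y z, s x y → s y z → s x z) (tri : ∀ x y, ¬ s x y → ¬ s y x → x = y)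
    (dense : ∀ x z, s x z → ∃ y, s x y ∧ s y z) (up : ∀ x, ∃ y, s x y) (down : ∀ x, ∃ y, s y x) :
    ∃ e : Q ≃ ℚ, ∀ a b, s a b ↔ e a < e b := by
  classical
  have : IsStrictTotalOrder Q s := { irrefl := irr, trans := trans, trichotomous := tri }
  let _ : LinearOrder Q := linearOrderOfSTO s
  have : DenselyOrdered Q := ⟨fun x z h => dense x z h⟩
  have : NoMaxOrder Q := ⟨fun x => up x⟩
  have : NoMinOrder Q := ⟨fun x => down x⟩
  obtain ⟨e⟩ := Order.iso_of_countable_dense Q ℚ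
  exact ⟨e.toEquiv, fun a b => (e.lt_iff_lt (x := a) (y := b)).symm⟩

theorem back_T {X : Type*} [Countable X] [Nonempty X] {r : X → X → Prop} (H : HPO r)
    (hT : ∀ u v w, r u v → r u w ∨ r w v)
    {K : Set ℝ} (hK : IsCompact K) {m : ℝ}
    (hm : IsLeast K m) (hacc : AccPt m (Filter.principal K)) :
    ∃ C : Set (Set X), IsMaxChainIn (Copies r ∪ {∅}) C ∧ Nonempty (↥K ≃o ↥C) := by
  let S : Setoid X :=
    { r := fun x y => ¬ r x y ∧ ¬ r y x
      iseqv := ⟨fun x => ⟨H.irr x, H.irr x⟩, fun h => ⟨h.2, h.1⟩, by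
        intro x y z h1 h2
        refine ⟨fun h => ?_, fun h => ?_⟩
        · rcases hT x z y h with h | h
          · exact h1.1 h
          · exact h2.1 h
        · rcases hT z x y h with h | h
          · exact h2.2 h
          · exact h1.2 h⟩ }
  have aux : ∀ a b a' b', (¬ r a a' ∧ ¬ r a' a) → (¬ r b b' ∧ ¬ r b' b) → r a b → r a' b' := by
    intro a b a' b' h1 h2 h
    rcases hT a b a' h with h3 | h3
    · exact absurd h3 h1.1
    · rcases hT a' b b' h3 with h4 | h4
      · exact h4
      · exact absurd h4 h2.2
  let s : Quotient S → Quotient S → Prop := Quotient.lift₂ r (by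
    intro a b a' b' h1 h2
    exact propext ⟨aux _ _ _ _ h1 h2, aux _ _ _ _ ⟨h1.2, h1.1⟩ ⟨h2.2, h2.1⟩⟩)
  have : Nonempty (Quotient S) := ⟨Quotient.mk S (Classical.arbitrary X)⟩
  obtain ⟨e, he⟩ := rat_iso s (by rintro ⟨x⟩; exact H.irr x)
    (by rintro ⟨x⟩ ⟨y⟩ ⟨z⟩; exact H.trans x y z)
    (by rintro ⟨x⟩ ⟨y⟩ h1 h2; exact Quotient.sound ⟨h1, h2⟩)
    (by rintro ⟨x⟩ ⟨z⟩ h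
        obtain ⟨y, h⟩ := H.dense h
        exact ⟨Quotient.mk S y, h⟩)
    (by rintro ⟨x⟩; obtain ⟨y, h⟩ := H.up x; exact ⟨Quotient.mk S y, h⟩)
    (by rintro ⟨x⟩; obtain ⟨y, h⟩ := H.down x; exact ⟨Quotient.mk S y, h⟩)
  let π : X → ℚ := fun x => e (Quotient.mk S x)
  have hr : ∀ x y, r x y ↔ π x < π y := fun x y => he (Quotient.mk S x) (Quotient.mk S y)
  have hsurj : Function.Surjective π := fun q => by
    obtain ⟨x, hx⟩ := Quotient.exists_rep (e.symm q)
    exact ⟨x, by simp only [π, hx, e.apply_symm_apply]⟩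
  have hfib : ∀ p q, ∃ g : X ≃ X, π ⁻¹' {q} = g '' (π ⁻¹' {p}) := by
    intro p q
    obtain ⟨x, rfl⟩ := hsurj p
    obtain ⟨y, rfl⟩ := hsurj q
    obtain ⟨g, hg, hgx⟩ := H.aut1 x y
    have key : ∀ z, π z = π x ↔ π (g z) = π y := by
      intro z
      rw [← hgx]
      have h1 := hg x z
      have h2 := hg z x
      rw [hr, hr] at h1 h2
      constructor
      · intro h
        exact le_antisymm (not_lt.1 fun h' => absurd (h1.2 h') (not_lt.2 h.le))
          (not_lt.1 fun h' => absurd (h2.2 h') (not_lt.2 h.ge))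
      · intro h
        exact le_antisymm (not_lt.1 fun h' => absurd (h1.1 h') (not_lt.2 h.le))
          (not_lt.1 fun h' => absurd (h2.1 h') (not_lt.2 h.ge))
    refine ⟨g, ?_⟩
    ext z
    constructor
    · intro hz
      refine ⟨g.symm z, (key _).2 ?_, by simp⟩
      rw [g.apply_symm_apply]; exact hz
    · rintro ⟨w, hw, rfl⟩
      exact (key w).1 hw
  by_cases hinf : (π ⁻¹' {0}).Infinite
  · refine back_good H.irr H.hu H.up (goodH_weak π hr hsurj ?_) hK hm hacc
    intro q
    obtain ⟨g, hg⟩ := hfib 0 q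
    rw [hg]
    exact hinf.image g.injective.injOn
  · refine back_weak_fin H.irr H.hu H.up π hr hsurj (π ⁻¹' {0}).ncard ?_ hK hm hacc
    intro q
    obtain ⟨g, hg⟩ := hfib 0 q
    rw [hg]
    exact ⟨(Set.not_infinite.1 hinf).image _, Set.ncard_image_of_injective _ g.injective⟩

theorem back_chains {X : Type*} [Countable X] [Nonempty X] {r : X → X → Prop} (H : HPO r)
    (hV : ∀ a b c, r a b → r a c → b = c ∨ r b c ∨ r c b)
    (hΛ : ∀ a b c, r b a → r c a → b = c ∨ r b c ∨ r c b)
    {K : Set ℝ} (hK : IsCompact K) {m : ℝ}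
    (hm : IsLeast K m) (hacc : AccPt m (Filter.principal K)) :
    ∃ C : Set (Set X), IsMaxChainIn (Copies r ∪ {∅}) C ∧ Nonempty (↥K ≃o ↥C) := by
  let S : Setoid X :=
    { r := fun x y => x = y ∨ r x y ∨ r y x
      iseqv := ⟨fun x => Or.inl rfl, by
        intro x y h
        rcases h with h | h | h
        · exact Or.inl h.symm
        · exact Or.inr (Or.inr h)
        · exact Or.inr (Or.inl h), by
        intro x y z h1 h2
        rcases h1 with rfl | h1 | h1 <;> rcases h2 with rfl | h2 | h2
        · exact Or.inl rfl
        · exact Or.inr (Or.inl h2)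
        · exact Or.inr (Or.inr h2)
        · exact Or.inr (Or.inl h1)
        · exact Or.inr (Or.inl (H.trans _ _ _ h1 h2))
        · exact hΛ _ _ _ h1 h2
        · exact Or.inr (Or.inr h1)
        · exact hV _ _ _ h1 h2
        · exact Or.inr (Or.inr (H.trans _ _ _ h2 h1))⟩ }
  have hcls : ∀ x y, Quotient.mk S x = Quotient.mk S y ↔ (x = y ∨ r x y ∨ r y x) :=
    fun x y => Quotient.eq (r := S)
  have hex : ∀ c : Quotient S, ∃ e : {x // Quotient.mk S x = c} ≃ ℚ, ∀ a b, r a.1 b.1 ↔ e a < e b := by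
    intro c
    obtain ⟨x0, rfl⟩ := Quotient.exists_rep c
    have : Nonempty {x // Quotient.mk S x = Quotient.mk S x0} := ⟨⟨x0, rfl⟩⟩
    refine rat_iso (Q := {x // Quotient.mk S x = Quotient.mk S x0}) (fun a b => r a.1 b.1) (fun x => H.irr _) (fun x y z => H.trans _ _ _) ?_ ?_ ?_ ?_
    · intro x y h1 h2
      rcases (hcls x.1 y.1).1 (x.2.trans y.2.symm) with h | h | h
      · exact Subtype.ext h
      · exact absurd h h1
      · exact absurd h h2
    · intro x z h
      obtain ⟨y, h1, h2⟩ := H.dense h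
      exact ⟨⟨y, ((hcls x.1 y).2 (Or.inr (Or.inl h1))).symm.trans x.2⟩, h1, h2⟩
    · intro x
      obtain ⟨y, h1⟩ := H.up x.1
      exact ⟨⟨y, ((hcls x.1 y).2 (Or.inr (Or.inl h1))).symm.trans x.2⟩, h1⟩
    · intro x
      obtain ⟨y, h1⟩ := H.down x.1
      exact ⟨⟨y, ((hcls y x.1).2 (Or.inr (Or.inl h1))).trans x.2⟩, h1⟩
  choose e he using hex
  have key : ∀ (x : X) (c) (hc : Quotient.mk S x = c), e (Quotient.mk S x) ⟨x, rfl⟩ = e c ⟨x, hc⟩ := by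
    rintro x c rfl; rfl
  refine back_good H.irr H.hu H.up (goodH_comp (Quotient.mk S) (fun x => e _ ⟨x, rfl⟩) ?_ ?_ ?_) hK hm hacc
  · intro x y
    constructor
    · intro h
      have hc := (hcls x y).2 (Or.inr (Or.inl h))
      refine ⟨hc, ?_⟩
      rw [key x _ hc]
      exact (he _ ⟨x, hc⟩ ⟨y, rfl⟩).1 h
    · rintro ⟨hc, h⟩
      rw [key x _ hc] at h
      exact (he _ ⟨x, hc⟩ ⟨y, rfl⟩).2 h
  · intro x y hc h
    rw [key x _ hc] at h
    exact congrArg Subtype.val ((e _).injective h)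
  · intro x q
    refine ⟨((e _).symm q : {y // Quotient.mk S y = Quotient.mk S x}).1, ((e _).symm q).2, ?_⟩
    rw [key _ _ ((e (Quotient.mk S x)).symm q).2]
    simp


/-- Incomparability. -/
def Inc {X : Type*} (r : X → X → Prop) (x y : X) : Prop := x ≠ y ∧ ¬ r x y ∧ ¬ r y x

theorem Inc.symm {X : Type*} {r : X → X → Prop} {x y : X} (h : Inc r x y) : Inc r y x :=
  ⟨h.1.symm, h.2.2, h.2.1⟩

theorem Inc.dual {X : Type*} {r : X → X → Prop} {x y : X} (h : Inc r x y) :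
    Inc (fun a b => r b a) x y := ⟨h.1, h.2.2, h.2.1⟩

theorem Inc.map {X : Type*} {r : X → X → Prop} {x y : X} (h : Inc r x y) {g : X ≃ X}
    (hg : ∀ x y, r x y ↔ r (g x) (g y)) : Inc r (g x) (g y) :=
  ⟨fun e => h.1 (g.injective e), fun e => h.2.1 ((hg _ _).2 e), fun e => h.2.2 ((hg _ _).2 e)⟩

theorem four_cases {X : Type*} (r : X → X → Prop) (x y : X) :
    x = y ∨ r x y ∨ r y x ∨ Inc r x y := by
  unfold Inc; tauto

theorem HPO.aut_inc {X : Type*} {r : X → X → Prop} (H : HPO r) {y1 y2 z1 z2 : X}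
    (h1 : Inc r y1 y2) (h2 : Inc r z1 z2) :
    ∃ g : X ≃ X, (∀ x y, r x y ↔ r (g x) (g y)) ∧ g y1 = z1 ∧ g y2 = z2 :=
  H.aut2 ⟨fun e => absurd e h1.1, fun e => absurd e h2.1⟩
    ⟨fun e => absurd e h1.2.1, fun e => absurd e h2.2.1⟩
    ⟨fun e => absurd e h1.2.2, fun e => absurd e h2.2.2⟩

theorem HPO.aut_inc3 {X : Type*} {r : X → X → Prop} (H : HPO r) {x y z x' y' z' : X}
    (h1 : Inc r x y) (h2 : Inc r x z) (h3 : Inc r y z)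
    (h1' : Inc r x' y') (h2' : Inc r x' z') (h3' : Inc r y' z') :
    ∃ g : X ≃ X, (∀ x y, r x y ↔ r (g x) (g y)) ∧ g x = x' ∧ g y = y' ∧ g z = z' := by
  have key : ∀ {a b c d : X}, Inc r a b → Inc r c d → (a = b ↔ c = d) ∧ (r a b ↔ r c d) := by
    intro a b c d h1 h2
    exact ⟨⟨fun e => absurd e h1.1, fun e => absurd e h2.1⟩,
      ⟨fun e => absurd e h1.2.1, fun e => absurd e h2.2.1⟩⟩
  have hF : ({(x, x'), (y, y'), (z, z')} : Set (X × X)).Finite := by simp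
  obtain ⟨g, hg1, hg2⟩ := exists_aut H.hu hF (by
    intro p hp q hq
    simp only [Set.mem_insert_iff, Set.mem_singleton_iff] at hp hq
    rcases hp with rfl | rfl | rfl <;> rcases hq with rfl | rfl | rfl
    · simp [H.irr]
    · exact key h1 h1'
    · exact key h2 h2'
    · exact key h1.symm h1'.symm
    · simp [H.irr]
    · exact key h3 h3'
    · exact key h2.symm h2'.symm
    · exact key h3.symm h3'.symm
    · simp [H.irr])
  exact ⟨g, hg1, hg2 (x, x') (by simp), hg2 (y, y') (by simp), hg2 (z, z') (by simp)⟩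

theorem HPO.nt1 {X : Type*} {r : X → X → Prop} (H : HPO r)
    (hNT : ∃ u v w, r u v ∧ Inc r w u ∧ Inc r w v) {a b : X} (hab : Inc r a b) :
    ∃ y, r a y ∧ Inc r y b := by
  obtain ⟨u, v, w, h1, h2, h3⟩ := hNT
  obtain ⟨g, hg, e1, e2⟩ := H.aut_inc h2.symm hab
  exact ⟨g v, e1 ▸ (hg u v).1 h1, e2 ▸ (h3.symm.map hg)⟩

theorem HPO.nt_dual {X : Type*} {r : X → X → Prop}
    (hNT : ∃ u v w, r u v ∧ Inc r w u ∧ Inc r w v) :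
    ∃ u v w, r v u ∧ Inc (fun a b => r b a) w u ∧ Inc (fun a b => r b a) w v := by
  obtain ⟨u, v, w, h1, h2, h3⟩ := hNT
  exact ⟨v, u, w, h1, h3.dual, h2.dual⟩

theorem HPO.nt2 {X : Type*} {r : X → X → Prop} (H : HPO r)
    (hNT : ∃ u v w, r u v ∧ Inc r w u ∧ Inc r w v) {a b : X} (hab : Inc r a b) :
    ∃ y, r y a ∧ Inc r y b := by
  obtain ⟨y, h1, h2⟩ := H.dual.nt1 (HPO.nt_dual hNT) hab.dual
  exact ⟨y, h1, h2.dual⟩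

theorem HPO.V_imp_L {X : Type*} {r : X → X → Prop} (H : HPO r)
    (hNT : ∃ u v w, r u v ∧ Inc r w u ∧ Inc r w v)
    (hV : ∃ a b c, r a b ∧ r a c ∧ Inc r b c) : ∃ a b c, r b a ∧ r c a ∧ Inc r b c := by
  by_contra hno
  have hch : ∀ x y z, r x z → r y z → x = y ∨ r x y ∨ r y x := by
    intro x y z h1 h2
    rcases four_cases r x y with h | h | h | h
    · exact Or.inl h
    · exact Or.inr (Or.inl h)
    · exact Or.inr (Or.inr h)
    · exact absurd ⟨z, x, y, h1, h2, h⟩ hno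
  obtain ⟨a, b, c, hab, hac, hbc⟩ := hV
  obtain ⟨a', ha'b, ha'c⟩ := H.nt2 hNT hbc
  obtain ⟨g, hg, e1, e2⟩ := H.aut_lt hab ha'b
  have hac' : r a' (g c) := e1 ▸ (hg _ _).1 hac
  have hbc' : Inc r b (g c) := by
    have := hbc.map hg
    rwa [e2] at this
  generalize g c = c' at hac' hbc'
  have hcc' : Inc r c c' := by
    refine ⟨?_, ?_, ?_⟩
    · rintro rfl; exact ha'c.2.1 hac'
    · intro h
      rcases hch _ _ _ hac' h with h | h | h
      · exact ha'c.1 h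
      · exact ha'c.2.1 h
      · exact ha'c.2.2 h
    · intro h
      exact ha'c.2.1 (H.trans _ _ _ hac' h)
  obtain ⟨k, hk, k1, k2, k3⟩ := H.aut_inc3 hbc hbc' hcc' hbc' hbc hcc'.symm
  have hI : ∀ x, r x b → r x c → r x c' := by
    intro x h1 h2
    rcases hch _ _ _ h1 ha'b with h | h | h
    · exact absurd (h ▸ h2) ha'c.2.1
    · exact H.trans _ _ _ h hac'
    · exact absurd (H.trans _ _ _ h h2) ha'c.2.1
  have h1 : r (k.symm a') b := by rw [hk, k.apply_symm_apply, k1]; exact ha'b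
  have h2 : r (k.symm a') c := by rw [hk, k.apply_symm_apply, k2]; exact hac'
  have h3 := hI _ h1 h2
  rw [hk, k.apply_symm_apply, k3] at h3
  exact ha'c.2.1 h3

theorem HPO.L_imp_V {X : Type*} {r : X → X → Prop} (H : HPO r)
    (hNT : ∃ u v w, r u v ∧ Inc r w u ∧ Inc r w v)
    (hL : ∃ a b c, r b a ∧ r c a ∧ Inc r b c) : ∃ a b c, r a b ∧ r a c ∧ Inc r b c := by
  obtain ⟨a, b, c, h1, h2, h3⟩ := H.dual.V_imp_L (HPO.nt_dual hNT) (by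
    obtain ⟨a, b, c, h1, h2, h3⟩ := hL
    exact ⟨a, b, c, h1, h2, h3.dual⟩)
  exact ⟨a, b, c, h1, h2, h3.dual⟩

/-- Homogeneous posets of random type. -/
structure RP {X : Type*} (r : X → X → Prop) : Prop extends HPO r where
  nt : ∃ u v w, r u v ∧ Inc r w u ∧ Inc r w v
  V : ∃ a b c, r a b ∧ r a c ∧ Inc r b c
  L : ∃ a b c, r b a ∧ r c a ∧ Inc r b c

theorem RP.dual {X : Type*} {r : X → X → Prop} (H : RP r) : RP (fun x y => r y x) := by
  refine ⟨H.toHPO.dual, HPO.nt_dual H.nt, ?_, ?_⟩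
  · obtain ⟨a, b, c, h1, h2, h3⟩ := H.L
    exact ⟨a, b, c, h1, h2, h3.dual⟩
  · obtain ⟨a, b, c, h1, h2, h3⟩ := H.V
    exact ⟨a, b, c, h1, h2, h3.dual⟩

theorem RP.up2 {X : Type*} {r : X → X → Prop} (H : RP r) (x y : X) : ∃ c, r x c ∧ r y c := by
  rcases four_cases r x y with rfl | h | h | h
  · obtain ⟨c, hc⟩ := H.up x; exact ⟨c, hc, hc⟩
  · obtain ⟨c, hc⟩ := H.up y; exact ⟨c, H.trans _ _ _ h hc, hc⟩
  · obtain ⟨c, hc⟩ := H.up x; exact ⟨c, hc, H.trans _ _ _ h hc⟩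
  · obtain ⟨a, b, c, h1, h2, h3⟩ := H.L
    obtain ⟨g, hg, rfl, rfl⟩ := H.aut_inc h3 h
    exact ⟨g a, (hg _ _).1 h1, (hg _ _).1 h2⟩

theorem RP.upF {X : Type*} {r : X → X → Prop} (H : RP r) (A : Finset X) :
    ∃ c, ∀ a ∈ A, r a c := by
  classical
  induction A using Finset.induction_on with
  | empty => obtain ⟨x, _⟩ := H.ex; exact ⟨x, by simp⟩
  | insert a s _ ih =>
    obtain ⟨c, hc⟩ := ih
    obtain ⟨d, h1, h2⟩ := H.up2 a c
    refine ⟨d, fun b hb => ?_⟩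
    rcases Finset.mem_insert.1 hb with rfl | hb
    · exact h1
    · exact H.trans _ _ _ (hc b hb) h2

/-- Move a finite configuration above a finite set. -/
theorem RP.move {X : Type*} {r : X → X → Prop} (H : RP r) (A F : Finset X) :
    ∃ g : X ≃ X, (∀ x y, r x y ↔ r (g x) (g y)) ∧ ∀ a ∈ A, ∀ f ∈ F, r a (g f) := by
  obtain ⟨c, hc⟩ := H.upF A
  obtain ⟨d, hd⟩ := H.dual.upF F
  obtain ⟨g, hg, e⟩ := H.aut1 d c
  refine ⟨g, hg, fun a ha f hf => H.trans _ _ _ (hc a ha) ?_⟩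
  rw [← e]; exact (hg _ _).1 (hd f hf)

theorem RP.sameT {X : Type*} {r : X → X → Prop} (H : RP r) {A : Finset X} {z w : X}
    (hz : ∀ a ∈ A, r a z) (hw : ∀ a ∈ A, r a w) : SameType r (A : Set X) z w := by
  intro a ha
  exact ⟨⟨fun _ => hw a ha, fun _ => hz a ha⟩,
    ⟨fun h => absurd h (H.asymm (hz a ha)), fun h => absurd h (H.asymm (hw a ha))⟩⟩

theorem RP.notMemT {X : Type*} {r : X → X → Prop} (H : RP r) {A : Finset X} {z : X}
    (hz : ∀ a ∈ A, r a z) : z ∉ (A : Set X) := fun h => H.irr _ (hz z h)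

theorem RP.noMin {X : Type*} {r : X → X → Prop} (H : RP r) {A : Finset X} {z : X}
    (hz : ∀ a ∈ A, r a z) : ∃ w, (∀ a ∈ A, r a w) ∧ r w z := by
  obtain ⟨y, hy⟩ := H.up z
  have hyA : ∀ a ∈ A, r a y := fun a ha => H.trans _ _ _ (hz a ha) hy
  obtain ⟨g, hg, hgA, e⟩ := H.autA1 A.finite_toSet (H.notMemT hyA) (H.notMemT hz) (H.sameT hyA hz)
  refine ⟨g z, fun a ha => ?_, by have h := (hg _ _).1 hy; rwa [e] at h⟩
  have := (hg _ _).1 (hz a ha)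
  rwa [hgA a ha] at this

theorem RP.G2a {X : Type*} {r : X → X → Prop} (H : RP r) {a x y : X} (hxy : r x y)
    (hya : Inc r y a) : ∃ c, r a c ∧ r x c ∧ ¬ r y c := by
  classical
  by_contra hno
  push Not at hno
  by_cases hxa' : r x a
  · exact hya.2.2 (by
      -- c just above a
      obtain ⟨c, h1, h2⟩ := H.nt1 H.nt hya.symm
      exact absurd (hno c h1 (H.trans _ _ _ hxa' h1)) h2.2.2)
  have hax : Inc r a x := by
    rcases four_cases r a x with h | h | h | h
    · exact absurd (h ▸ hxy) hya.2.2
    · exact absurd (H.trans _ _ _ h hxy) hya.2.2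
    · exact absurd h hxa'
    · exact h
  have key : ∀ z z', r x z → r x z' → Inc r z z' → r a z → r a z' := by
    intro z z' hz hz' hzz haz
    by_contra h
    have hz'a : Inc r z' a := by
      refine ⟨?_, ?_, h⟩
      · rintro rfl; exact hax.2.2 hz'
      · intro h'; exact hax.2.2 (H.trans _ _ _ hz' h')
    obtain ⟨g, hg, hgA, e⟩ := H.autA1 (A := {x, a}) (by simp) (y := y) (z := z')
      (by
        simp only [mem_insert_iff, mem_singleton_iff, not_or]
        exact ⟨(H.ne hxy).symm, hya.1⟩)
      (by
        simp only [mem_insert_iff, mem_singleton_iff, not_or]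
        exact ⟨(H.ne hz').symm, hz'a.1⟩)
      (by
        intro b hb
        simp only [mem_insert_iff, mem_singleton_iff] at hb
        rcases hb with rfl | rfl
        · simp [hxy, hz', H.asymm hxy, H.asymm hz']
        · simp [hya.2.1, hya.2.2, hz'a.2.1, hz'a.2.2])
    have hgx : g x = x := hgA x (by simp)
    have hga : g a = a := hgA a (by simp)
    have h1 := hno (g.symm z) (by rw [hg, g.apply_symm_apply, hga]; exact haz)
      (by rw [hg, g.apply_symm_apply, hgx]; exact hz)
    rw [hg, g.apply_symm_apply, e] at h1
    exact hzz.2.2 h1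
  obtain ⟨c, hac, hxc⟩ := H.up2 a x
  have hyc := hno c hac hxc
  obtain ⟨u, v, w, huv, hwu, hwv⟩ := H.nt
  obtain ⟨k, hk, hkx⟩ := H.move {x} {u, v, w}
  have hxu : r x (k u) := hkx x (by simp) u (by simp)
  have hxv : r x (k v) := hkx x (by simp) v (by simp)
  have hxw : r x (k w) := hkx x (by simp) w (by simp)
  have huv' := (hk _ _).1 huv
  have hT : ∀ {p q : X}, r x p → r x q → SameType r ({x} : Set X) p q := by
    intro p q hp hq b hb
    rw [mem_singleton_iff] at hb
    subst hb
    simp [hp, hq, H.asymm hp, H.asymm hq]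
  obtain ⟨g, hg, hgA, e1, e2⟩ := H.autA2 (A := {x}) (by simp) (y1 := k u) (y2 := k v) (z1 := y) (z2 := c)
    (by simpa using (H.ne hxu).symm) (by simpa using (H.ne hxv).symm)
    (by simpa using (H.ne hxy).symm) (by simpa using (H.ne hxc).symm)
    ⟨fun e => absurd e (H.ne huv'), fun e => absurd e (H.ne hyc)⟩
    ⟨fun _ => hyc, fun _ => huv'⟩
    ⟨fun e => absurd e (H.asymm huv'), fun e => absurd e (H.asymm hyc)⟩ (hT hxu hxy) (hT hxv hxc)
  have hgx : g x = x := hgA x (by simp)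
  have hxw' : r x (g (k w)) := by
    have := (hg _ _).1 hxw
    rwa [hgx] at this
  have h1 : Inc r (g (k w)) y := by
    have := (hwu.map hk).map hg
    rwa [e1] at this
  have h2 : Inc r (g (k w)) c := by
    have := (hwv.map hk).map hg
    rwa [e2] at this
  exact hya.2.2 (key _ _ hxw' hxy h1 (key _ _ hxc hxw' h2.symm hac))

theorem RP.G2b {X : Type*} {r : X → X → Prop} (H : RP r) {a x y : X} (hax : Inc r a x)
    (hay : Inc r a y) (hxy : Inc r x y) : ∃ c, r a c ∧ r x c ∧ ¬ r y c := by
  by_contra hno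
  push Not at hno
  have hall : ∀ p q s, Inc r p q → Inc r p s → Inc r q s → ∀ c, r p c → r q c → r s c := by
    intro p q s h1 h2 h3 c hp hq
    obtain ⟨g, hg, e1, e2, e3⟩ := H.aut_inc3 hax hay hxy h1 h2 h3
    have := hno (g.symm c) (by rw [hg, e1, g.apply_symm_apply]; exact hp)
      (by rw [hg, e2, g.apply_symm_apply]; exact hq)
    rw [hg, e3, g.apply_symm_apply] at this
    exact this
  obtain ⟨z, hxz, hza⟩ := H.nt1 H.nt hax.symm
  have hzy : Inc r z y := by
    rcases four_cases r z y with h | h | h | h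
    · exact absurd (h ▸ hxz) hxy.2.1
    · exact absurd (H.trans _ _ _ hxz h) hxy.2.1
    · exact absurd (hall x y a hxy hax.symm hay.symm z hxz h) hza.2.2
    · exact h
  obtain ⟨c, hc1, hc2, hc3⟩ := H.G2a hxz hza
  exact hc3 (hall a y z hay hza.symm hzy.symm c hc1 (hno c hc1 hc2))

theorem RP.G1 {X : Type*} {r : X → X → Prop} (H : RP r) {a y : X} (h1 : y ≠ a) (h2 : ¬ r y a) :
    ∃ c, r a c ∧ ¬ r y c := by
  by_cases h : r a y
  · exact ⟨y, h, H.irr y⟩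
  · obtain ⟨c, hc, hc2⟩ := H.nt1 H.nt (show Inc r a y from ⟨h1.symm, h, h2⟩)
    exact ⟨c, hc, hc2.2.2⟩

theorem RP.G2 {X : Type*} {r : X → X → Prop} (H : RP r) {a x y : X} (ha1 : y ≠ a) (ha2 : ¬ r y a)
    (hx1 : y ≠ x) (hx2 : ¬ r y x) : ∃ c, r a c ∧ r x c ∧ ¬ r y c := by
  rcases four_cases r a x with rfl | h | h | h
  · obtain ⟨c, h1, h2⟩ := H.G1 ha1 ha2
    exact ⟨c, h1, h1, h2⟩
  · obtain ⟨c, h1, h2⟩ := H.G1 hx1 hx2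
    exact ⟨c, H.trans _ _ _ h h1, h1, h2⟩
  · obtain ⟨c, h1, h2⟩ := H.G1 ha1 ha2
    exact ⟨c, h1, H.trans _ _ _ h h1, h2⟩
  · by_cases hay : r a y <;> by_cases hxy : r x y
    · exact ⟨y, hay, hxy, H.irr y⟩
    · obtain ⟨c, h1, h2, h3⟩ := H.G2a hay (show Inc r y x from ⟨hx1, hx2, hxy⟩)
      exact ⟨c, h2, h1, h3⟩
    · exact H.G2a hxy (show Inc r y a from ⟨ha1, ha2, hay⟩)
    · exact H.G2b h ⟨ha1.symm, hay, ha2⟩ ⟨hx1.symm, hxy, hx2⟩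

theorem RP.Gstar {X : Type*} {r : X → X → Prop} (H : RP r) (A : Finset X) (y : X)
    (hy : ∀ a ∈ A, y ≠ a ∧ ¬ r y a) : ∃ c, (∀ a ∈ A, r a c) ∧ y ≠ c ∧ ¬ r y c := by
  classical
  induction A using Finset.induction_on with
  | empty => obtain ⟨c, hc⟩ := H.down y; exact ⟨c, by simp, (H.ne hc).symm, H.asymm hc⟩
  | insert a s _ ih =>
    obtain ⟨c0, h1, h2, h3⟩ := ih (fun a ha => hy a (Finset.mem_insert_of_mem ha))
    have hya := hy a (Finset.mem_insert_self _ _)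
    obtain ⟨c, h4, h5, h6⟩ := H.G2 hya.1 hya.2 h2 h3
    have hcA : ∀ b ∈ insert a s, r b c := by
      intro b hb
      rcases Finset.mem_insert.1 hb with rfl | hb
      · exact h4
      · exact H.trans _ _ _ (h1 b hb) h5
    by_cases hyc : y = c
    · subst hyc
      obtain ⟨w, hw1, hw2⟩ := H.noMin hcA
      exact ⟨w, hw1, (H.ne hw2).symm, H.asymm hw2⟩
    · exact ⟨c, hcA, hyc, h6⟩

theorem RP.downT {X : Type*} {r : X → X → Prop} (H : RP r) {A : Finset X} {z z' : X}
    (hz : ∀ a ∈ A, r a z) (hz' : ∀ a ∈ A, r a z') : ∃ w, (∀ a ∈ A, r a w) ∧ r w z ∧ r w z' := by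
  classical
  rcases four_cases r z z' with rfl | h | h | h
  · obtain ⟨w, h1, h2⟩ := H.noMin hz; exact ⟨w, h1, h2, h2⟩
  · obtain ⟨w, h1, h2⟩ := H.noMin hz; exact ⟨w, h1, h2, H.trans _ _ _ h2 h⟩
  · obtain ⟨w, h1, h2⟩ := H.noMin hz'; exact ⟨w, h1, H.trans _ _ _ h2 h, h2⟩
  · obtain ⟨a0, b0, c0, hab, hac, hbc⟩ := H.V
    obtain ⟨k, hk, hkA⟩ := H.move A {a0, b0, c0}
    have hA0 : ∀ a ∈ A, r a (k a0) := fun a ha => hkA a ha a0 (by simp)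
    have hB0 : ∀ a ∈ A, r a (k b0) := fun a ha => hkA a ha b0 (by simp)
    have hC0 : ∀ a ∈ A, r a (k c0) := fun a ha => hkA a ha c0 (by simp)
    have hbc' := hbc.map hk
    obtain ⟨g, hg, hgA, e1, e2⟩ := H.autA2 A.finite_toSet (H.notMemT hB0) (H.notMemT hC0)
      (H.notMemT hz) (H.notMemT hz') ⟨fun e => absurd e hbc'.1, fun e => absurd e h.1⟩
      ⟨fun e => absurd e hbc'.2.1, fun e => absurd e h.2.1⟩
      ⟨fun e => absurd e hbc'.2.2, fun e => absurd e h.2.2⟩ (H.sameT hB0 hz) (H.sameT hC0 hz')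
    refine ⟨g (k a0), fun a ha => ?_, ?_, ?_⟩
    · have := (hg _ _).1 (hA0 a ha)
      rwa [hgA a ha] at this
    · rw [← e1]; exact (hg _ _).1 ((hk _ _).1 hab)
    · rw [← e2]; exact (hg _ _).1 ((hk _ _).1 hac)

theorem RP.interp {X : Type*} {r : X → X → Prop} (H : RP r) (A C : Finset X)
    (h : ∀ a ∈ A, ∀ c ∈ C, r a c) : ∃ w, (∀ a ∈ A, r a w) ∧ ∀ c ∈ C, r w c := by
  classical
  induction C using Finset.induction_on with
  | empty => obtain ⟨c, hc⟩ := H.upF A; exact ⟨c, hc, by simp⟩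
  | insert c s _ ih =>
    obtain ⟨w, h1, h2⟩ := ih (fun a ha c hc => h a ha c (Finset.mem_insert_of_mem hc))
    obtain ⟨v, h3, h4, h5⟩ := H.downT h1 (fun a ha => h a ha c (Finset.mem_insert_self _ _))
    refine ⟨v, h3, fun d hd => ?_⟩
    rcases Finset.mem_insert.1 hd with rfl | hd
    · exact h5
    · exact H.trans _ _ _ h4 (h2 d hd)

theorem RP.Gss {X : Type*} {r : X → X → Prop} (H : RP r) (A Y : Finset X)
    (hy : ∀ y ∈ Y, ∀ a ∈ A, y ≠ a ∧ ¬ r y a) : ∃ c, (∀ a ∈ A, r a c) ∧ ∀ y ∈ Y, ¬ r y c := by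
  classical
  have : ∀ y : X, ∃ c, y ∈ Y → (∀ a ∈ A, r a c) ∧ ¬ r y c := by
    intro y
    by_cases h : y ∈ Y
    · obtain ⟨c, h1, _, h2⟩ := H.Gstar A y (hy y h)
      exact ⟨c, fun _ => ⟨h1, h2⟩⟩
    · exact ⟨y, fun h' => absurd h' h⟩
  choose f hf using this
  obtain ⟨w, h1, h2⟩ := H.interp A (Y.image f) (by
    intro a ha c hc
    obtain ⟨y, hy, rfl⟩ := Finset.mem_image.1 hc
    exact (hf y hy).1 a ha)
  refine ⟨w, h1, fun y hy h => (hf y hy).2 (H.trans _ _ _ h (h2 _ (Finset.mem_image_of_mem f hy)))⟩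

theorem RP.exInc {X : Type*} {r : X → X → Prop} (H : RP r) (U : Finset X) :
    ∃ d, ∀ u ∈ U, Inc r d u := by
  classical
  obtain ⟨f, hf⟩ := H.dual.upF U
  obtain ⟨c, hc⟩ := H.upF (insert f U)
  obtain ⟨u, v, w, huv, hwu, hwv⟩ := H.nt
  obtain ⟨g, hg, rfl, rfl⟩ := H.aut_lt huv (hc f (Finset.mem_insert_self _ _))
  have h1 := hwu.map hg
  have h2 := hwv.map hg
  refine ⟨g w, fun x hx => ?_⟩
  have h3 := hf x hx
  have h4 := hc x (Finset.mem_insert_of_mem hx)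
  refine ⟨?_, ?_, ?_⟩
  · rintro rfl; exact h2.2.1 h4
  · intro h; exact h2.2.1 (H.trans _ _ _ h h4)
  · intro h; exact h1.2.2 (H.trans _ _ _ h3 h)

theorem RP.ext {X : Type*} {r : X → X → Prop} (H : RP r) (L G U : Finset X)
    (hLG : ∀ l ∈ L, ∀ g ∈ G, r l g) (hUL : ∀ u ∈ U, ∀ l ∈ L, u ≠ l ∧ ¬ r u l)
    (hUG : ∀ u ∈ U, ∀ g ∈ G, u ≠ g ∧ ¬ r g u) :
    ∃ p, (∀ l ∈ L, r l p) ∧ (∀ g ∈ G, r p g) ∧ ∀ u ∈ U, Inc r p u := by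
  classical
  obtain ⟨d0, hd0⟩ := H.exInc U
  obtain ⟨d1, hd1, hd1U⟩ := H.dual.Gss (insert d0 G) U (by
    intro u hu g hg
    rcases Finset.mem_insert.1 hg with rfl | hg
    · exact ⟨(hd0 u hu).1.symm, (hd0 u hu).2.1⟩
    · exact hUG u hu g hg)
  have hd10 : r d1 d0 := hd1 d0 (Finset.mem_insert_self _ _)
  obtain ⟨c1, hc1, hc1U⟩ := H.Gss (insert d1 L) U (by
    intro u hu l hl
    rcases Finset.mem_insert.1 hl with rfl | hl
    · refine ⟨?_, ?_⟩
      · rintro rfl; exact (hd0 u hu).2.2 hd10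
      · intro h; exact (hd0 u hu).2.2 (H.trans _ _ _ h hd10)
    · exact hUL u hu l hl)
  obtain ⟨p, h1, h2⟩ := H.interp (insert d1 L) (insert c1 G) (by
    intro l hl g hg
    rcases Finset.mem_insert.1 hg with rfl | hg
    · exact hc1 l hl
    · rcases Finset.mem_insert.1 hl with rfl | hl
      · exact hd1 g (Finset.mem_insert_of_mem hg)
      · exact hLG l hl g hg)
  have hd1p := h1 d1 (Finset.mem_insert_self _ _)
  have hpc1 := h2 c1 (Finset.mem_insert_self _ _)
  refine ⟨p, fun l hl => h1 l (Finset.mem_insert_of_mem hl),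
    fun g hg => h2 g (Finset.mem_insert_of_mem hg), fun u hu => ⟨?_, ?_, ?_⟩⟩
  · rintro rfl; exact hd1U p hu hd1p
  · intro h; exact hd1U u hu (H.trans _ _ _ hd1p h)
  · intro h; exact hc1U u hu (H.trans _ _ _ h hpc1)


theorem RP.good {X : Type*} [Countable X] {r : X → X → Prop} (H : RP r) : ∃ h : X → ℚ, GoodH r h := by
  classical
  let Good : Finset (X × ℚ) → Prop := fun F =>
    ∀ p ∈ F, ∀ q ∈ F, (p.1 = q.1 → p.2 = q.2) ∧ (r p.1 q.1 → p.2 < q.2)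
  let D : X ⊕ (Finset X × X × ℚ × Finset X) ⊕ (ℚ × ℚ) → Finset (X × ℚ) → Prop := fun i F =>
    match i with
    | Sum.inl x => ∃ v, (x, v) ∈ F
    | Sum.inr (Sum.inl (A, y, q, E)) => (∀ a ∈ A, ∃ v, (a, v) ∈ F) ∧
        (y ∉ A → (∀ a v, a ∈ A → (a, v) ∈ F → v < q) →
          ∃ z v, (z, v) ∈ F ∧ z ∉ A ∧ z ∉ E ∧ SameType r (A : Set X) y z ∧ v < q)
    | Sum.inr (Sum.inr (p, q)) => p < q → ∃ x v, (x, v) ∈ F ∧ p < v ∧ v < q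
  have add1 : ∀ (F : Finset (X × ℚ)) (x : X) (v : ℚ), Good F → (∀ w, (x, w) ∉ F) →
      (∀ a w, (a, w) ∈ F → (r a x → w < v) ∧ (r x a → v < w)) → Good (insert (x, v) F) := by
    intro F x v hF hx hv p hp q hq
    obtain ⟨p1, p2⟩ := p
    obtain ⟨q1, q2⟩ := q
    rw [Finset.mem_insert, Prod.mk.injEq] at hp hq
    rcases hp with ⟨rfl, rfl⟩ | hp <;> rcases hq with ⟨rfl, rfl⟩ | hq
    · exact ⟨fun _ => rfl, fun h => absurd h (H.irr _)⟩
    · refine ⟨fun h => ?_, (hv _ _ hq).2⟩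
      have h' : p1 = q1 := h
      exact absurd (h' ▸ hq) (hx q2)
    · refine ⟨fun h => ?_, (hv _ _ hp).1⟩
      have h' : p1 = q1 := h
      exact absurd (h' ▸ hp) (hx p2)
    · exact hF _ hp _ hq
  have addx : ∀ (F : Finset (X × ℚ)) (x : X), Good F → ∃ F', F ⊆ F' ∧ Good F' ∧ ∃ v, (x, v) ∈ F' := by
    intro F x hF
    by_cases hx : ∃ v, (x, v) ∈ F
    · exact ⟨F, subset_rfl, hF, hx⟩
    push Not at hx
    obtain ⟨v, hv1, hv2⟩ := Order.exists_between_finsets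
      ((F.filter (fun p => r p.1 x)).image Prod.snd) ((F.filter (fun p => r x p.1)).image Prod.snd) (by
        intro a ha b hb
        obtain ⟨p, hp, rfl⟩ := Finset.mem_image.1 ha
        obtain ⟨q, hq, rfl⟩ := Finset.mem_image.1 hb
        rw [Finset.mem_filter] at hp hq
        exact (hF p hp.1 q hq.1).2 (H.trans _ _ _ hp.2 hq.2))
    refine ⟨insert (x, v) F, Finset.subset_insert _ _, add1 F x v hF hx ?_, v, Finset.mem_insert_self _ _⟩
    intro a w haw
    exact ⟨fun h => hv1 w (Finset.mem_image.2 ⟨(a, w), Finset.mem_filter.2 ⟨haw, h⟩, rfl⟩),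
      fun h => hv2 w (Finset.mem_image.2 ⟨(a, w), Finset.mem_filter.2 ⟨haw, h⟩, rfl⟩)⟩
  have addF : ∀ (F : Finset (X × ℚ)) (B : Finset X), Good F →
      ∃ F', F ⊆ F' ∧ Good F' ∧ ∀ x ∈ B, ∃ v, (x, v) ∈ F' := by
    intro F B hF
    induction B using Finset.induction_on with
    | empty => exact ⟨F, subset_rfl, hF, by simp⟩
    | insert b s _ ih =>
      obtain ⟨F1, h1, h2, h3⟩ := ih
      obtain ⟨F2, h4, h5, h6⟩ := addx F1 b h2
      refine ⟨F2, h1.trans h4, h5, fun x hx => ?_⟩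
      rcases Finset.mem_insert.1 hx with rfl | hx
      · exact h6
      · obtain ⟨v, hv⟩ := h3 x hx
        exact ⟨v, h4 hv⟩
  obtain ⟨s, hs1, hs2, hs3⟩ := generic_seq Good (by simp [Good]) D (by
    rintro (x | ⟨A, y, q, E⟩ | ⟨p, q⟩) F hF
    · exact addx F x hF
    · obtain ⟨F1, hF1, hG1, hdom⟩ := addF F (A ∪ E) hF
      by_cases hcond : y ∉ A ∧ (∀ a v, a ∈ A → (a, v) ∈ F1 → v < q)
      swap
      · exact ⟨F1, hF1, hG1, fun a ha => hdom a (Finset.mem_union_left _ ha),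
          fun h1 h2 => absurd ⟨h1, h2⟩ hcond⟩
      obtain ⟨hyA, hAq⟩ := hcond
      let S := F1.image Prod.fst
      have hS : ∀ x, x ∈ S ↔ ∃ v, (x, v) ∈ F1 := by
        intro x
        simp only [S, Finset.mem_image]
        constructor
        · rintro ⟨⟨a, b⟩, h, rfl⟩; exact ⟨b, h⟩
        · rintro ⟨v, h⟩; exact ⟨(x, v), h, rfl⟩
      let L := S.filter (fun s => ∃ l ∈ A, r l y ∧ (s = l ∨ r s l))
      let G := S.filter (fun s => ∃ g ∈ A, r y g ∧ (s = g ∨ r g s))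
      let U := S.filter (fun s => s ∉ L ∧ s ∉ G)
      have hLy : ∀ l ∈ L, r l y := by
        intro l hl
        obtain ⟨_, l0, _, h1, rfl | h2⟩ := Finset.mem_filter.1 hl
        · exact h1
        · exact H.trans _ _ _ h2 h1
      have hyG : ∀ g ∈ G, r y g := by
        intro l hl
        obtain ⟨_, l0, _, h1, rfl | h2⟩ := Finset.mem_filter.1 hl
        · exact h1
        · exact H.trans _ _ _ h1 h2
      have hAS : ∀ a ∈ A, a ∈ S := fun a ha => (hS a).2 (hdom a (Finset.mem_union_left _ ha))
      obtain ⟨p, hp1, hp2, hp3⟩ := H.ext L G U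
        (fun l hl g hg => H.trans _ _ _ (hLy l hl) (hyG g hg))
        (by
          intro u hu l hl
          obtain ⟨huS, huL, _⟩ := Finset.mem_filter.1 hu
          refine ⟨?_, ?_⟩
          · rintro rfl; exact huL hl
          · intro h
            obtain ⟨_, l0, hl0, h1, h2⟩ := Finset.mem_filter.1 hl
            refine huL (Finset.mem_filter.2 ⟨huS, l0, hl0, h1, Or.inr ?_⟩)
            rcases h2 with rfl | h2
            · exact h
            · exact H.trans _ _ _ h h2)
        (by
          intro u hu l hl
          obtain ⟨huS, _, huG⟩ := Finset.mem_filter.1 hu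
          refine ⟨?_, ?_⟩
          · rintro rfl; exact huG hl
          · intro h
            obtain ⟨_, l0, hl0, h1, h2⟩ := Finset.mem_filter.1 hl
            refine huG (Finset.mem_filter.2 ⟨huS, l0, hl0, h1, Or.inr ?_⟩)
            rcases h2 with rfl | h2
            · exact h
            · exact H.trans _ _ _ h2 h)
      have hcov : ∀ s ∈ S, s ∈ L ∨ s ∈ G ∨ s ∈ U := by
        intro s hs
        by_cases h1 : s ∈ L
        · exact Or.inl h1
        by_cases h2 : s ∈ G
        · exact Or.inr (Or.inl h2)
        exact Or.inr (Or.inr (Finset.mem_filter.2 ⟨hs, h1, h2⟩))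
      have hpS : p ∉ S := by
        intro h
        rcases hcov p h with h | h | h
        · exact H.irr _ (hp1 p h)
        · exact H.irr _ (hp2 p h)
        · exact (hp3 p h).1 rfl
      have hbelow : ∀ s ∈ S, r s p → s ∈ L := by
        intro s hs hsp
        rcases hcov s hs with h | h | h
        · exact h
        · exact absurd (hp2 s h) (H.asymm hsp)
        · exact absurd hsp (hp3 s h).2.2
      have habove : ∀ s ∈ S, r p s → s ∈ G := by
        intro s hs hsp
        rcases hcov s hs with h | h | h
        · exact absurd (hp1 s h) (H.asymm hsp)
        · exact h
        · exact absurd hsp (hp3 s h).2.1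
      have hST : SameType r (A : Set X) y p := by
        intro a ha
        have ha : a ∈ A := ha
        refine ⟨⟨fun h => hp1 a ?_, fun h => hLy a (hbelow a (hAS a ha) h)⟩,
          ⟨fun h => hp2 a ?_, fun h => hyG a (habove a (hAS a ha) h)⟩⟩
        · exact Finset.mem_filter.2 ⟨hAS a ha, a, ha, h, Or.inl rfl⟩
        · exact Finset.mem_filter.2 ⟨hAS a ha, a, ha, h, Or.inl rfl⟩
      have hpF : ∀ w, (p, w) ∉ F1 := fun w hw => hpS ((hS p).2 ⟨w, hw⟩)
      obtain ⟨v, hv1, hv2⟩ := Order.exists_between_finsets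
        ((F1.filter (fun t => r t.1 p)).image Prod.snd)
        (insert q ((F1.filter (fun t => r p t.1)).image Prod.snd)) (by
          intro a ha b hb
          obtain ⟨⟨t, w⟩, ht, rfl⟩ := Finset.mem_image.1 ha
          rw [Finset.mem_filter] at ht
          rcases Finset.mem_insert.1 hb with rfl | hb
          · have htL := hbelow t ((hS t).2 ⟨w, ht.1⟩) ht.2
            obtain ⟨_, l, hlA, _, h2⟩ := Finset.mem_filter.1 htL
            rcases h2 with rfl | h2
            · exact hAq t w hlA ht.1
            · obtain ⟨w', hw'⟩ := hdom l (Finset.mem_union_left _ hlA)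
              exact ((hG1 _ ht.1 _ hw').2 h2).trans (hAq l w' hlA hw')
          · obtain ⟨⟨t', w'⟩, ht', rfl⟩ := Finset.mem_image.1 hb
            rw [Finset.mem_filter] at ht'
            exact (hG1 _ ht.1 _ ht'.1).2 (H.trans _ _ _ ht.2 ht'.2))
      refine ⟨insert (p, v) F1, hF1.trans (Finset.subset_insert _ _), add1 F1 p v hG1 hpF ?_, ?_, ?_⟩
      · intro a w haw
        exact ⟨fun h => hv1 w (Finset.mem_image.2 ⟨(a, w), Finset.mem_filter.2 ⟨haw, h⟩, rfl⟩),
          fun h => hv2 w (Finset.mem_insert_of_mem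
            (Finset.mem_image.2 ⟨(a, w), Finset.mem_filter.2 ⟨haw, h⟩, rfl⟩))⟩
      · intro a ha
        obtain ⟨w, hw⟩ := hdom a (Finset.mem_union_left _ ha)
        exact ⟨w, Finset.mem_insert_of_mem hw⟩
      · intro _ _
        refine ⟨p, v, Finset.mem_insert_self _ _, fun h => hpS (hAS p h), fun h => ?_, hST,
          hv2 q (Finset.mem_insert_self _ _)⟩
        obtain ⟨w, hw⟩ := hdom p (Finset.mem_union_right _ h)
        exact hpF w hw
    · by_cases hpq : p < q
      · obtain ⟨x, hx⟩ := H.exInc (F.image Prod.fst)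
        obtain ⟨v, hv⟩ := exists_between hpq
        have hx' : ∀ a w, (a, w) ∈ F → Inc r x a := fun a w h =>
          hx a (Finset.mem_image.2 ⟨(a, w), h, rfl⟩)
        refine ⟨insert (x, v) F, Finset.subset_insert _ _, add1 F x v hF ?_ ?_,
          fun _ => ⟨x, v, Finset.mem_insert_self _ _, hv⟩⟩
        · intro w hw; exact (hx' x w hw).1 rfl
        · intro a w haw
          exact ⟨fun h => absurd h (hx' a w haw).2.2, fun h => absurd h (hx' a w haw).2.1⟩
      · exact ⟨F, subset_rfl, hF, fun h => absurd h hpq⟩)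
  have hdef : ∀ x, ∃ v, ∃ n, (x, v) ∈ s n := by
    intro x
    obtain ⟨n, v, h⟩ := hs3 (Sum.inl x)
    exact ⟨v, n, h⟩
  choose h nh hh using hdef
  have hcomp : ∀ p q : X × ℚ, (∃ n, p ∈ s n) → (∃ n, q ∈ s n) →
      (p.1 = q.1 → p.2 = q.2) ∧ (r p.1 q.1 → p.2 < q.2) := by
    rintro p q ⟨n, hn⟩ ⟨m, hm⟩
    exact hs2 (max n m) p (hs1 (le_max_left n m) hn) q (hs1 (le_max_right n m) hm)
  have huniq : ∀ x v n, (x, v) ∈ s n → v = h x := fun x v n hv =>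
    (hcomp (x, v) (x, h x) ⟨n, hv⟩ ⟨_, hh x⟩).1 rfl
  refine ⟨h, ?_, ?_, ?_⟩
  · intro x y hxy
    exact (hcomp (x, h x) (y, h y) ⟨_, hh x⟩ ⟨_, hh y⟩).2 hxy
  · intro A y q hy hA hfin
    obtain ⟨n, _, h2⟩ := hs3 (Sum.inr (Sum.inl (A, y, q, hfin.toFinset)))
    obtain ⟨z, v, hz, hzA, hzE, hzT, hzq⟩ := h2 hy (by
      intro a v ha hav
      rw [huniq a v n hav]; exact hA a ha)
    rw [huniq z v n hz] at hzq
    exact hzE (hfin.mem_toFinset.2 ⟨hzA, hzT, hzq⟩)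
  · intro p q hpq
    obtain ⟨n, h2⟩ := hs3 (Sum.inr (Sum.inr (p, q)))
    obtain ⟨x, v, hx, h3, h4⟩ := h2 hpq
    rw [huniq x v n hx] at h3 h4
    exact ⟨x, h3, h4⟩

theorem backward {X : Type*} [Countable X] [Nonempty X] {r : X → X → Prop} (H : HPO r)
    {K : Set ℝ} (hK : IsCompact K) {m : ℝ}
    (hm : IsLeast K m) (hacc : AccPt m (Filter.principal K)) :
    ∃ C : Set (Set X), IsMaxChainIn (Copies r ∪ {∅}) C ∧ Nonempty (↥K ≃o ↥C) := by
  by_cases hT : ∀ u v w, r u v → r u w ∨ r w v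
  · exact back_T H hT hK hm hacc
  have hNT : ∃ u v w, r u v ∧ Inc r w u ∧ Inc r w v := by
    push Not at hT
    obtain ⟨u, v, w, h1, h2, h3⟩ := hT
    refine ⟨u, v, w, h1, ⟨?_, ?_, h2⟩, ⟨?_, h3, ?_⟩⟩
    · rintro rfl; exact h3 h1
    · intro h; exact h3 (H.trans _ _ _ h h1)
    · rintro rfl; exact h2 h1
    · intro h; exact h2 (H.trans _ _ _ h1 h)
  by_cases hV : ∃ a b c, r a b ∧ r a c ∧ Inc r b c
  · obtain ⟨h, hg⟩ := (RP.mk H hNT hV (H.V_imp_L hNT hV)).good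
    exact back_good H.irr H.hu H.up hg hK hm hacc
  by_cases hL : ∃ a b c, r b a ∧ r c a ∧ Inc r b c
  · exact absurd (H.L_imp_V hNT hL) hV
  refine back_chains H ?_ ?_ hK hm hacc
  · intro a b c h1 h2
    rcases four_cases r b c with h | h | h | h
    · exact Or.inl h
    · exact Or.inr (Or.inl h)
    · exact Or.inr (Or.inr h)
    · exact absurd ⟨a, b, c, h1, h2, h⟩ hV
  · intro a b c h1 h2
    rcases four_cases r b c with h | h | h | h
    · exact Or.inl h
    · exact Or.inr (Or.inl h)
    · exact Or.inr (Or.inr h)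
    · exact absurd ⟨a, b, c, h1, h2, h⟩ hL

theorem proper_copy {X : Type*} [Countable X] [Nonempty X] {r : X → X → Prop} (H : HPO r) :
    ∃ A, IsCopy r A ∧ A ≠ univ := by
  have hacc : AccPt (0 : ℝ) (Filter.principal (Icc (0 : ℝ) 1)) := by
    rw [accPt_iff_nhds]
    intro U hU
    obtain ⟨u, hu, hsub⟩ := exists_Ico_subset_of_mem_nhds hU ⟨1, one_pos⟩
    obtain ⟨c, hc1, hc2⟩ := exists_between (lt_min hu one_pos)
    exact ⟨c, ⟨hsub ⟨hc1.le, hc2.trans_le (min_le_left _ _)⟩, hc1.le,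
      (hc2.trans_le (min_le_right _ _)).le⟩, hc1.ne'⟩
  obtain ⟨C, hC, ⟨e⟩⟩ := backward H (isCompact_Icc (a := (0:ℝ)) (b := 1))
    (isLeast_Icc zero_le_one) hacc
  let a : Icc (0 : ℝ) 1 := ⟨0, by norm_num, by norm_num⟩
  let b : Icc (0 : ℝ) 1 := ⟨1/2, by norm_num, by norm_num⟩
  let c : Icc (0 : ℝ) 1 := ⟨1, by norm_num, by norm_num⟩
  have hab : e a < e b := e.lt_iff_lt.2 (by change (0:ℝ) < 1/2; norm_num)
  have hbc : e b < e c := e.lt_iff_lt.2 (by change (1/2 : ℝ) < 1; norm_num)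
  rcases hC.1 (e b).2 with h | h
  · refine ⟨_, h, fun hu => ?_⟩
    have h1 : (e b).1 ⊂ (e c).1 := hbc
    rw [hu] at h1
    exact h1.2 (subset_univ _)
  · have h1 : (e a).1 ⊂ (e b).1 := hab
    rw [mem_singleton_iff] at h
    rw [h] at h1
    exact absurd (empty_subset _) h1.2

theorem statement_1 {X : Type*} [Countable X] [Infinite X] (r : X → X → Prop)
    (hirr : ∀ x, ¬ r x x) (htrans : ∀ x y z, r x y → r y z → r x z)
    (hultra : UltrahomogeneousRel r) (hnotanti : ∃ x y, r x y)
    (L : Type*) [LinearOrder L] :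
    (∃ C : Set (Set X), IsMaxChainIn (Copies r ∪ {∅}) C ∧ Nonempty (L ≃o ↥C)) ↔
      (∃ K : Set ℝ, IsCompact K ∧ (∃ m, IsLeast K m ∧ AccPt m (Filter.principal K)) ∧
        Nonempty (L ≃o ↥K)) := by
  have H : HPO r := ⟨hirr, htrans, hultra, hnotanti⟩
  constructor
  · rintro ⟨C, hC, ⟨e⟩⟩
    exact forward_dir hirr hultra (proper_copy H) hC e
  · rintro ⟨K, hK, ⟨m, hm, hacc⟩, ⟨e⟩⟩
    obtain ⟨C, hC, ⟨e'⟩⟩ := backward H hK hm hacc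
    exact ⟨C, hC, ⟨e.trans e'⟩⟩
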